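/- For every dimension d ≥ 1 there exists a constant c_d > 0 such that the following holds. Let X_1, …, X_{d+1} be finite sets of points in ℝ^d whose union is in general position. Then there exist a point q ∈ ℝ^d and subsets Y_1 ⊆ X_1, …, Y_{d+1} ⊆ X_{d+1} with |Y_i| ≥ c_d·|X_i| for all i, such that for every choice of points x_1 ∈ Y_1, …, x_{d+1} ∈ Y_{d+1}, the point q is contained in conv{x_1, …, x_{d+1}}. -/

import Mathlib

/-- A set of points in `ℝ^d` is in general position if no `d+1` of them lie on a common
hyperplane, i.e. every `d+1` distinct points of it are affinely independent. -/
def InGeneralPosition {d : ℕ} (S : Set (EuclideanSpace ℝ (Fin d))) : Prop :=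
  ∀ f : Fin (d + 1) → EuclideanSpace ℝ (Fin d),
    (∀ i, f i ∈ S) → Function.Injective f → AffineIndependent ℝ f

namespace PachAux
open Finset

/-! ### Chains mod 2 on lists, subdivision, Sperner, Brouwer -/

noncomputable section Chains
variable {P : Type*}

/-- boundary of a list -/
def bdl : List P → (List P →₀ ZMod 2)
  | [] => 0
  | b :: l => Finsupp.single l 1 + Finsupp.lmapDomain (ZMod 2) (ZMod 2) (List.cons b) (bdl l)

/-- cone operator -/
def cone (b : P) : (List P →₀ ZMod 2) →ₗ[ZMod 2] (List P →₀ ZMod 2) :=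
  Finsupp.lmapDomain (ZMod 2) (ZMod 2) (List.cons b)

lemma cone_single (b : P) (l : List P) (r : ZMod 2) :
    cone b (Finsupp.single l r) = Finsupp.single (b :: l) r := by
  simp [cone]

/-- boundary operator -/
def BD : (List P →₀ ZMod 2) →ₗ[ZMod 2] (List P →₀ ZMod 2) :=
  Finsupp.linearCombination (ZMod 2) bdl

lemma BD_single (l : List P) : BD (Finsupp.single l 1) = bdl l := by
  simp [BD]

lemma chain_ext {M : Type*} [AddCommGroup M] [Module (ZMod 2) M]
    {f g : (List P →₀ ZMod 2) →ₗ[ZMod 2] M}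
    (h : ∀ l, f (Finsupp.single l 1) = g (Finsupp.single l 1)) : f = g := by
  apply Finsupp.lhom_ext'
  intro l
  apply LinearMap.ext_ring
  simpa using h l

lemma add_self_chain {M : Type*} [AddCommGroup M] [Module (ZMod 2) M] (c : M) : c + c = 0 := by
  have : (2 : ZMod 2) • c = 0 := by
    have h : (2 : ZMod 2) = 0 := by decide
    rw [h, zero_smul]
  rwa [two_smul] at this

lemma BD_cone (b : P) (c : List P →₀ ZMod 2) : BD (cone b c) = c + cone b (BD c) := by
  have : BD ∘ₗ cone b = LinearMap.id + cone b ∘ₗ BD := by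
    apply chain_ext
    intro l
    simp only [LinearMap.comp_apply, cone_single, BD_single, LinearMap.add_apply, LinearMap.id_apply]
    rfl
  exact congrArg (fun f => f c) this

lemma bdl_cons (b : P) (l : List P) :
    bdl (b :: l) = Finsupp.single l 1 + cone b (bdl l) := rfl

lemma BD_bdl (l : List P) : BD (bdl l) = 0 := by
  induction l with
  | nil => simp [bdl]
  | cons b l ih =>
    rw [bdl_cons, map_add, BD_single, BD_cone, ih, map_zero, add_zero, add_self_chain]

lemma BD_BD (c : List P →₀ ZMod 2) : BD (BD c) = 0 := by
  have : (BD ∘ₗ BD : (List P →₀ ZMod 2) →ₗ[ZMod 2] _) = 0 := by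
    apply chain_ext
    intro l
    simp [BD_single, BD_bdl]
  exact congrArg (fun f => f c) this

/-- subdivision -/
def sdl (β : List P → P) : ℕ → List P → (List P →₀ ZMod 2)
  | 0, l => Finsupp.single l 1
  | n + 1, l => cone (β l) (Finsupp.linearCombination (ZMod 2) (sdl β n) (bdl l))

/-- subdivision operator -/
def SD (β : List P → P) (n : ℕ) : (List P →₀ ZMod 2) →ₗ[ZMod 2] (List P →₀ ZMod 2) :=
  Finsupp.linearCombination (ZMod 2) (sdl β n)

lemma SD_single (β : List P → P) (n : ℕ) (l : List P) :
    SD β n (Finsupp.single l 1) = sdl β n l := by simp [SD]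

lemma SD_zero (β : List P → P) (c) : SD β 0 c = c := by
  have : SD β 0 = LinearMap.id := by
    apply chain_ext; intro l; simp [SD_single, sdl]
  rw [this]; rfl

lemma sdl_succ (β : List P → P) (n : ℕ) (l : List P) :
    sdl β (n+1) l = cone (β l) (SD β n (bdl l)) := rfl

lemma BD_SD (β : List P → P) (n : ℕ) (c) : BD (SD β (n+1) c) = SD β n (BD c) := by
  induction n generalizing c with
  | zero =>
    have : BD ∘ₗ SD β 1 = SD β 0 ∘ₗ BD := by
      apply chain_ext
      intro l
      simp only [LinearMap.comp_apply, SD_single, BD_single, sdl_succ, BD_cone, SD_zero, BD_bdl,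
        map_zero, add_zero]
    exact congrArg (fun f => f c) this
  | succ n ih =>
    have : BD ∘ₗ SD β (n+1+1) = SD β (n+1) ∘ₗ BD := by
      apply chain_ext
      intro l
      simp only [LinearMap.comp_apply, SD_single, BD_single]
      rw [sdl_succ, BD_cone, ih, BD_bdl, map_zero, map_zero, add_zero]
    exact congrArg (fun f => f c) this

lemma BD_SD_iter (β : List P → P) (n N : ℕ) (c) :
    BD ((SD β (n+1))^[N] c) = (SD β n)^[N] (BD c) := by
  induction N generalizing c with
  | zero => rfl
  | succ N ih => rw [Function.iterate_succ_apply, ih, BD_SD, ← Function.iterate_succ_apply]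

/-- chains supported on lists with property A -/
def Sup (A : List P → Prop) : Submodule (ZMod 2) (List P →₀ ZMod 2) :=
  Finsupp.supported (ZMod 2) (ZMod 2) {l | A l}

lemma mem_Sup {A : List P → Prop} {c : List P →₀ ZMod 2} :
    c ∈ Sup A ↔ ∀ l ∈ c.support, A l := by
  rw [Sup, Finsupp.mem_supported]; rfl

lemma single_mem_Sup {A : List P → Prop} {l : List P} (h : A l) :
    Finsupp.single l (1 : ZMod 2) ∈ Sup A := Finsupp.single_mem_supported _ _ h

lemma linComb_mem {M : Type*} [AddCommGroup M] [Module (ZMod 2) M]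
    {A : List P → Prop} (S : Submodule (ZMod 2) M) (f : List P → M)
    (h : ∀ l, A l → f l ∈ S) {c : List P →₀ ZMod 2} (hc : c ∈ Sup A) :
    Finsupp.linearCombination (ZMod 2) f c ∈ S := by
  rw [Finsupp.linearCombination_apply]
  apply Submodule.sum_mem
  intro l hl
  exact S.smul_mem _ (h l (mem_Sup.1 hc l hl))

lemma cone_mem {A B : List P → Prop} (b : P) (h : ∀ l, A l → B (b :: l))
    {c : List P →₀ ZMod 2} (hc : c ∈ Sup A) : cone b c ∈ Sup B := by
  have : cone b c = Finsupp.linearCombination (ZMod 2) (fun l => cone b (Finsupp.single l 1)) c := by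
    have : cone b = Finsupp.linearCombination (ZMod 2)
        (fun l : List P => cone b (Finsupp.single l 1)) := by
      apply chain_ext; intro l; simp
    exact congrArg (fun f => f c) this
  rw [this]
  apply linComb_mem (A := A) _ _ _ hc
  intro l hl
  rw [cone_single]
  exact single_mem_Sup (h l hl)

lemma bdl_mem (l : List P) :
    bdl l ∈ Sup (fun l' => l'.length + 1 = l.length ∧ (∀ x ∈ l', x ∈ l) ∧
      (l.Nodup → ∃ x ∈ l, x ∉ l')) := by
  induction l with
  | nil => simp [bdl]
  | cons b l ih =>
    rw [bdl_cons]
    apply Submodule.add_mem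
    · apply single_mem_Sup
      refine ⟨rfl, fun x hx => List.mem_cons_of_mem _ hx, fun h => ⟨b, by simp, ?_⟩⟩
      exact (List.nodup_cons.1 h).1
    · apply cone_mem b _ ih
      rintro l' ⟨h1, h2, h3⟩
      refine ⟨by simp [h1], ?_, ?_⟩
      · intro x hx
        rcases List.mem_cons.1 hx with rfl | hx
        · simp
        · exact List.mem_cons_of_mem _ (h2 x hx)
      · intro h
        obtain ⟨x, hx, hx'⟩ := h3 (List.nodup_cons.1 h).2
        refine ⟨x, List.mem_cons_of_mem _ hx, ?_⟩
        intro hx2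
        rcases List.mem_cons.1 hx2 with rfl | hx2
        · exact (List.nodup_cons.1 h).1 hx
        · exact hx' hx2

lemma iter_mem (A : List P → Prop) (f : (List P →₀ ZMod 2) →ₗ[ZMod 2] (List P →₀ ZMod 2))
    (h : ∀ c ∈ Sup A, f c ∈ Sup A) (N : ℕ) (c) (hc : c ∈ Sup A) : f^[N] c ∈ Sup A := by
  induction N generalizing c with
  | zero => exact hc
  | succ N ih => rw [Function.iterate_succ_apply]; exact ih _ (h c hc)

/-- counting by labels -/
def NN (ℓ : P → ℕ) (S : Multiset ℕ) : (List P →₀ ZMod 2) →ₗ[ZMod 2] ZMod 2 :=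
  Finsupp.linearCombination (ZMod 2)
    (fun l => if ((l.map ℓ : List ℕ) : Multiset ℕ) = S then 1 else 0)

lemma NN_single (ℓ : P → ℕ) (S : Multiset ℕ) (l : List P) :
    NN ℓ S (Finsupp.single l 1) = if ((l.map ℓ : List ℕ) : Multiset ℕ) = S then 1 else 0 := by
  simp [NN]

lemma NN_cone (ℓ : P → ℕ) (S : Multiset ℕ) (b : P) (c) :
    NN ℓ S (cone b c) = if ℓ b ∈ S then NN ℓ (S.erase (ℓ b)) c else 0 := by
  by_cases h : ℓ b ∈ S
  · rw [if_pos h]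
    have : NN ℓ S ∘ₗ cone b = NN ℓ (S.erase (ℓ b)) := by
      apply chain_ext
      intro l
      rw [LinearMap.comp_apply, cone_single, NN_single, NN_single]
      obtain ⟨T, rfl⟩ := Multiset.exists_cons_of_mem h
      simp [← Multiset.cons_coe]
    exact congrArg (fun f => f c) this
  · rw [if_neg h]
    have : NN ℓ S ∘ₗ cone b = 0 := by
      apply chain_ext
      intro l
      rw [LinearMap.comp_apply, cone_single, NN_single, if_neg]
      · rfl
      · rintro rfl
        simp at h
    exact congrArg (fun f => f c) this

lemma NN_bdl (ℓ : P → ℕ) (l : List P) : ∀ (S : Multiset ℕ),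
    (∀ v, ((l.map ℓ : List ℕ) : Multiset ℕ) = v ::ₘ S →
      NN ℓ S (bdl l) = ((Multiset.count v ((l.map ℓ : List ℕ) : Multiset ℕ) : ℕ) : ZMod 2)) ∧
    ((∀ v, ((l.map ℓ : List ℕ) : Multiset ℕ) ≠ v ::ₘ S) → NN ℓ S (bdl l) = 0) := by
  induction l with
  | nil => intro S; simp [bdl]
  | cons b l ih =>
    intro S
    set m : Multiset ℕ := ((l.map ℓ : List ℕ) : Multiset ℕ) with hm
    have hm' : (((b :: l).map ℓ : List ℕ) : Multiset ℕ) = ℓ b ::ₘ m := by simp [hm]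
    rw [hm', bdl_cons, map_add, NN_single, NN_cone, ← hm]
    constructor
    · intro v hv
      by_cases hb : ℓ b = v
      · subst hb
        have hmS : m = S := by simpa using hv
        rw [if_pos hmS]
        by_cases hbS : ℓ b ∈ S
        · obtain ⟨T, rfl⟩ := Multiset.exists_cons_of_mem hbS
          rw [if_pos hbS, ((ih _).1 (ℓ b) (by simpa using hmS))]
          rw [Multiset.count_cons_self]
          push_cast; ring
        · rw [if_neg hbS]
          rw [← hmS] at hbS
          simp [Multiset.count_eq_zero_of_notMem hbS]
      · have hmS : m ≠ S := by
          rintro h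
          rw [h] at hv
          exact hb ((Multiset.cons_inj_left S).1 hv)
        have hbS : ℓ b ∈ S := by
          have : ℓ b ∈ v ::ₘ S := hv ▸ Multiset.mem_cons_self _ _
          rcases Multiset.mem_cons.1 this with h | h
          · exact absurd h hb
          · exact h
        obtain ⟨T, rfl⟩ := Multiset.exists_cons_of_mem hbS
        rw [if_neg hmS, if_pos hbS, Multiset.erase_cons_head]
        have hT : m = v ::ₘ T := by
          rw [Multiset.cons_swap] at hv
          simpa using hv
        rw [(ih T).1 v hT, Multiset.count_cons_of_ne (Ne.symm hb), zero_add]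
    · intro hv
      have hmS : m ≠ S := by
        rintro h
        exact hv (ℓ b) (by rw [h])
      rw [if_neg hmS, zero_add]
      split_ifs with hbS
      · obtain ⟨T, rfl⟩ := Multiset.exists_cons_of_mem hbS
        rw [Multiset.erase_cons_head]
        apply (ih T).2
        intro v h
        apply hv v
        rw [h, Multiset.cons_swap]
      · rfl

lemma NN_step (ℓ : P → ℕ) (n : ℕ) (c : List P →₀ ZMod 2)
    (hc : c ∈ Sup (fun l => ∀ x ∈ l, ℓ x ≤ n)) :
    NN ℓ (Multiset.range (n+1)) c = NN ℓ (Multiset.range n) (BD c) := by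
  have key : ∀ l : List P, (∀ x ∈ l, ℓ x ≤ n) →
      NN ℓ (Multiset.range (n+1)) (Finsupp.single l 1) = NN ℓ (Multiset.range n) (bdl l) := by
    intro l hl
    rw [NN_single]
    set m : Multiset ℕ := ((l.map ℓ : List ℕ) : Multiset ℕ) with hm
    by_cases h : ∃ v, m = v ::ₘ Multiset.range n
    · obtain ⟨v, hv⟩ := h
      rw [(NN_bdl ℓ l _).1 v hv, ← hm, hv, Multiset.range_succ,
        Multiset.count_cons_self]
      simp only [Multiset.cons_inj_left]
      have hvn : v ≤ n := by
        have : v ∈ m := by rw [hv]; exact Multiset.mem_cons_self _ _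
        rw [hm] at this
        simp only [Multiset.mem_coe, List.mem_map] at this
        obtain ⟨x, hx, rfl⟩ := this
        exact hl x hx
      by_cases h2 : v = n
      · subst h2
        simp
      · rw [if_neg h2, Multiset.count_eq_one_of_mem (Multiset.nodup_range n)
          (Multiset.mem_range.2 (lt_of_le_of_ne hvn h2))]
        decide
    · push Not at h
      rw [(NN_bdl ℓ l _).2 h, if_neg]
      rw [Multiset.range_succ]
      exact h n
  have : c ∈ Sup (fun l => ∀ x ∈ l, ℓ x ≤ n) →
      NN ℓ (Multiset.range (n+1)) c - NN ℓ (Multiset.range n) (BD c) = 0 := by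
    intro hc
    have h1 : NN ℓ (Multiset.range (n+1)) c - NN ℓ (Multiset.range n) (BD c) =
      Finsupp.linearCombination (ZMod 2) (fun l => NN ℓ (Multiset.range (n+1)) (Finsupp.single l 1)
        - NN ℓ (Multiset.range n) (bdl l)) c := by
      have : NN ℓ (Multiset.range (n+1)) - NN ℓ (Multiset.range n) ∘ₗ BD =
        Finsupp.linearCombination (ZMod 2)
          (fun l => NN ℓ (Multiset.range (n+1)) (Finsupp.single l 1)
        - NN ℓ (Multiset.range n) (bdl l)) := by
        apply chain_ext
        intro l
        simp [BD_single]
      exact congrArg (fun f => f c) this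
    rw [h1]
    have := linComb_mem (A := fun l => ∀ x ∈ l, ℓ x ≤ n) (⊥ : Submodule (ZMod 2) (ZMod 2))
      (fun l => NN ℓ (Multiset.range (n+1)) (Finsupp.single l 1) - NN ℓ (Multiset.range n) (bdl l))
      (fun l hl => by rw [key l hl, sub_self]; exact Submodule.zero_mem _) hc
    simpa using this
  exact sub_eq_zero.1 (this hc)

lemma NN_zero_of (ℓ : P → ℕ) (S : Multiset ℕ) (i : ℕ) (hi : i ∈ S) (c : List P →₀ ZMod 2)
    (hc : c ∈ Sup (fun l => ∀ x ∈ l, ℓ x ≠ i)) : NN ℓ S c = 0 := by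
  have := linComb_mem (A := fun l => ∀ x ∈ l, ℓ x ≠ i) (⊥ : Submodule (ZMod 2) (ZMod 2))
    (fun l => if ((l.map ℓ : List ℕ) : Multiset ℕ) = S then (1 : ZMod 2) else 0) ?_ hc
  · simpa [NN] using this
  · intro l hl
    rw [if_neg]
    · simp
    · rintro rfl
      simp only [Multiset.mem_coe, List.mem_map] at hi
      obtain ⟨x, hx, h⟩ := hi
      exact hl x hx h

end Chains

end PachAux

namespace PachAux
open Finset

noncomputable section Brouwer

/-- barycentre of a list -/
def bary {V : Type*} [AddCommGroup V] [Module ℝ V] (l : List V) : V :=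
  (l.length : ℝ)⁻¹ • l.sum

lemma bary_mem {V : Type*} [AddCommGroup V] [Module ℝ V] {C : Set V}
    (hC : Convex ℝ C) (l : List V) (hl : l ≠ []) (h : ∀ x ∈ l, x ∈ C) : bary l ∈ C := by
  have hlen : 0 < l.length := List.length_pos_iff.2 hl
  have hsum : bary l = ∑ i : Fin l.length, (l.length : ℝ)⁻¹ • l.get i := by
    rw [bary, ← Finset.smul_sum]
    congr 1
    simpa using (Fin.sum_univ_getElem l).symm
  rw [hsum]
  apply hC.sum_mem
  · intro i _; positivity
  · simp; field_simp
  · intro i _; exact h _ (List.get_mem _ _)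

lemma sdl_hull {V : Type*} [AddCommGroup V] [Module ℝ V] {C : Set V}
    (hC : Convex ℝ C) (n : ℕ) (l : List V) (h : ∀ x ∈ l, x ∈ C) :
    sdl bary n l ∈ Sup (fun l' => ∀ x ∈ l', x ∈ C) := by
  induction n generalizing l with
  | zero => exact single_mem_Sup h
  | succ n ih =>
    rw [sdl_succ]
    by_cases hl : l = []
    · subst hl; simp [bdl]
    · apply cone_mem (A := fun l' => ∀ x ∈ l', x ∈ C)
      · intro l' hl' x hx
        rcases List.mem_cons.1 hx with rfl | hx
        · exact bary_mem hC l hl h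
        · exact hl' x hx
      · apply linComb_mem _ _ _ (bdl_mem l)
        rintro l' ⟨_, h2, _⟩
        exact ih l' (fun x hx => h x (h2 x hx))

lemma SD_hull {V : Type*} [AddCommGroup V] [Module ℝ V] {C : Set V}
    (hC : Convex ℝ C) (n N : ℕ) (c : List V →₀ ZMod 2)
    (h : c ∈ Sup (fun l' => ∀ x ∈ l', x ∈ C)) :
    (SD bary n)^[N] c ∈ Sup (fun l' => ∀ x ∈ l', x ∈ C) :=
  iter_mem _ _ (fun _ hc => linComb_mem _ _ (fun l hl => sdl_hull hC n l hl) hc) N c h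


lemma sum_sub_norm_le {V : Type*} [NormedAddCommGroup V] [NormedSpace ℝ V] (l : List V) (v : V)
    (D : ℝ) (hD : ∀ x ∈ l, ‖x - v‖ ≤ D) :
    ‖l.sum - (l.length : ℝ) • v‖ ≤ l.length * D := by
  induction l with
  | nil => simp
  | cons a l ih =>
    have h1 := ih (fun x hx => hD x (List.mem_cons_of_mem _ hx))
    have h2 := hD a (by simp)
    have : (a :: l).sum - ((a :: l).length : ℝ) • v = (a - v) + (l.sum - (l.length : ℝ) • v) := by
      simp only [List.sum_cons, List.length_cons]; push_cast; module
    rw [this]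
    calc _ ≤ ‖a - v‖ + ‖l.sum - (l.length : ℝ) • v‖ := norm_add_le _ _
      _ ≤ D + l.length * D := by gcongr
      _ = _ := by simp only [List.length_cons]; push_cast; ring

lemma bary_dist {V : Type*} [NormedAddCommGroup V] [NormedSpace ℝ V] (l : List V) (r D : ℝ)
    (hD0 : 0 ≤ D) (hr : (l.length : ℝ) - 1 ≤ r * l.length)
    (hD : ∀ x ∈ l, ∀ y ∈ l, dist x y ≤ D) (y : V) (hy : y ∈ convexHull ℝ {x | x ∈ l}) :
    dist y (bary l) ≤ r * D := by
  have : convexHull ℝ {x | x ∈ l} ⊆ Metric.closedBall (bary l) (r * D) := by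
    apply convexHull_min _ (convex_closedBall _ _)
    intro v hv
    have hv : v ∈ l := hv
    rw [Metric.mem_closedBall]
    obtain ⟨s, t, hst⟩ := List.append_of_mem hv
    have hlen : l.length = s.length + t.length + 1 := by rw [hst]; simp; ring
    have hpos : (0 : ℝ) < l.length := by rw [hlen]; positivity
    have e1 : v - bary l = -((l.length : ℝ)⁻¹ • ((s ++ t).sum - ((s ++ t).length : ℝ) • v)) := by
      have : (l.length : ℝ) • (v - bary l) = -((s ++ t).sum - ((s ++ t).length : ℝ) • v) := by
        rw [bary, smul_sub, smul_smul, mul_inv_cancel₀ hpos.ne', one_smul, hlen, hst]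
        simp only [List.sum_append, List.sum_cons, List.length_append]
        push_cast
        module
      rw [← smul_neg, ← this, smul_smul, inv_mul_cancel₀ hpos.ne', one_smul]
    rw [dist_eq_norm, e1, norm_neg, norm_smul, norm_inv, Real.norm_of_nonneg hpos.le]
    have h2 := sum_sub_norm_le (s ++ t) v D (fun x hx => by
      rw [← dist_eq_norm]
      apply hD x _ v hv
      rw [hst]
      simp only [List.mem_append, List.mem_cons] at hx ⊢
      tauto)
    have h3 : (((s ++ t).length : ℕ) : ℝ) = l.length - 1 := by
      rw [hlen]; simp
    rw [h3] at h2 ⊢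
    rw [inv_mul_le_iff₀ hpos]
    calc _ ≤ _ := h2
      _ ≤ (r * l.length) * D := by gcongr
      _ = _ := by ring
  exact this hy

lemma sdl_mesh {V : Type*} [NormedAddCommGroup V] [NormedSpace ℝ V] (r D : ℝ) (hD0 : 0 ≤ D)
    (n : ℕ) (hr : ∀ m : ℕ, m ≤ n → (m : ℝ) - 1 ≤ r * m) (hr0 : 0 ≤ r) (l : List V) (hl : l.length = n)
    (hD : ∀ x ∈ l, ∀ y ∈ l, dist x y ≤ D) :
    sdl bary n l ∈ Sup (fun l' => l'.length = n ∧ (∀ x ∈ l', x ∈ convexHull ℝ {x | x ∈ l}) ∧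
      ∀ x ∈ l', ∀ y ∈ l', dist x y ≤ r * D) := by
  induction n generalizing l with
  | zero =>
    have : l = [] := List.length_eq_zero_iff.1 hl
    subst this
    apply single_mem_Sup; simp
  | succ n ih =>
    rw [sdl_succ]
    have hl0 : l ≠ [] := by rintro rfl; simp at hl
    apply cone_mem (A := fun l' => l'.length = n ∧ (∀ x ∈ l', x ∈ convexHull ℝ {x | x ∈ l}) ∧
      ∀ x ∈ l', ∀ y ∈ l', dist x y ≤ r * D)
    · rintro l' ⟨h1, h2, h3⟩
      have hb : ∀ y ∈ l', dist y (bary l) ≤ r * D := fun y hy =>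
        bary_dist l r D hD0 (by rw [hl]; exact hr _ le_rfl) hD y (h2 y hy)
      refine ⟨by simp [h1], ?_, ?_⟩
      · intro x hx
        rcases List.mem_cons.1 hx with rfl | hx
        · exact bary_mem (convex_convexHull _ _) l hl0 (fun x hx => subset_convexHull _ _ hx)
        · exact h2 x hx
      · intro x hx y hy
        rcases List.mem_cons.1 hx with rfl | hx <;> rcases List.mem_cons.1 hy with rfl | hy
        · rw [dist_self]; positivity
        · rw [dist_comm]; exact hb y hy
        · exact hb x hx
        · exact h3 x hx y hy
    · apply linComb_mem _ _ _ (bdl_mem l)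
      rintro l' ⟨h1, h2, _⟩
      have := ih (fun m hm => hr m (by omega)) l' (by omega)
        (fun x hx y hy => hD x (h2 x hx) y (h2 y hy))
      rw [mem_Sup] at this ⊢
      intro l'' hl''
      obtain ⟨a, b, c⟩ := this l'' hl''
      exact ⟨a, fun x hx => convexHull_mono (fun z hz => h2 z hz) (b x hx), c⟩

lemma SD_mesh {V : Type*} [NormedAddCommGroup V] [NormedSpace ℝ V] (r D : ℝ) (hD0 : 0 ≤ D)
    (n : ℕ) (hr : ∀ m : ℕ, m ≤ n → (m : ℝ) - 1 ≤ r * m) (hr0 : 0 ≤ r) (N : ℕ) (l : List V)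
    (hl : l.length = n) (hD : ∀ x ∈ l, ∀ y ∈ l, dist x y ≤ D) :
    (SD bary n)^[N] (Finsupp.single l 1) ∈
      Sup (fun l' => l'.length = n ∧ ∀ x ∈ l', ∀ y ∈ l', dist x y ≤ r ^ N * D) := by
  induction N with
  | zero => apply single_mem_Sup; simpa [hl] using hD
  | succ N ih =>
    rw [Function.iterate_succ_apply']
    apply linComb_mem _ _ _ ih
    rintro l' ⟨h1, h2⟩
    have := sdl_mesh r (r ^ N * D) (by positivity) n hr hr0 l' h1 h2
    rw [mem_Sup] at this ⊢
    intro l'' hl''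
    obtain ⟨a, b, c⟩ := this l'' hl''
    refine ⟨a, fun x hx y hy => (c x hx y hy).trans_eq (by ring)⟩

/-- vertices of the standard simplex, as a list (descending) -/
def vl (d : ℕ) : ℕ → List (Fin (d+1) → ℝ)
  | 0 => []
  | k + 1 => (fun j => if (j : ℕ) = k then 1 else 0) :: vl d k

lemma mem_vl {d k : ℕ} {x : Fin (d+1) → ℝ} (hx : x ∈ vl d k) :
    ∃ i < k, x = fun j : Fin (d+1) => if (j : ℕ) = i then 1 else 0 := by
  induction k with
  | zero => simp [vl] at hx
  | succ k ih =>
    rcases List.mem_cons.1 hx with rfl | hx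
    · exact ⟨k, by omega, rfl⟩
    · obtain ⟨i, hi, h⟩ := ih hx; exact ⟨i, by omega, h⟩

lemma vl_length (d k : ℕ) : (vl d k).length = k := by
  induction k with
  | zero => rfl
  | succ k ih => simp [vl, ih]

lemma vtx_inj {d i j : ℕ} (hi : i < d + 1)
    (h : (fun m : Fin (d+1) => if (m : ℕ) = i then (1:ℝ) else 0) =
      fun m : Fin (d+1) => if (m : ℕ) = j then (1:ℝ) else 0) : i = j := by
  have := congrFun h ⟨i, hi⟩
  by_contra hne
  simp [hne] at this

lemma vl_nodup (d k : ℕ) (hk : k ≤ d + 1) : (vl d k).Nodup := by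
  induction k with
  | zero => simp [vl]
  | succ k ih =>
    rw [vl, List.nodup_cons]
    refine ⟨?_, ih (by omega)⟩
    intro h
    obtain ⟨i, hi, h⟩ := mem_vl h
    have := vtx_inj (by omega) h
    omega

lemma sperner (d N : ℕ) (ℓ : (Fin (d+1) → ℝ) → ℕ)
    (hℓ : ∀ x ∈ stdSimplex ℝ (Fin (d+1)), ∃ i : Fin (d+1), ℓ x = i ∧ 0 < x i)
    (k : ℕ) (hk : k ≤ d + 1) :
    NN ℓ (Multiset.range k) ((SD bary k)^[N] (Finsupp.single (vl d k) 1)) = 1 := by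
  have hstd : ∀ i < d + 1, (fun m : Fin (d+1) => if (m : ℕ) = i then (1:ℝ) else 0) ∈
      stdSimplex ℝ (Fin (d+1)) := by
    intro i hi
    refine ⟨fun m => by dsimp only; split_ifs <;> norm_num, ?_⟩
    rw [Finset.sum_eq_single ⟨i, hi⟩]
    · simp
    · intro b _ hb
      rw [if_neg]
      intro h
      exact hb (Fin.ext h)
    · simp
  induction k with
  | zero =>
    have : (SD bary 0)^[N] (Finsupp.single (vl d 0) 1) = Finsupp.single (vl d 0) 1 := by
      induction N with
      | zero => rfl
      | succ N ih => rw [Function.iterate_succ_apply, SD_zero, ih]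
    rw [this, NN_single]
    simp [vl]
  | succ k ih =>
    have ih := ih (by omega)
    have hconv : ∀ i : Fin (d+1), Convex ℝ (stdSimplex ℝ (Fin (d+1)) ∩ {x | x i = 0}) := by
      intro i
      apply (convex_stdSimplex ℝ _).inter
      intro x hx y hy a b _ _ _
      simp only [Set.mem_setOf_eq] at hx hy ⊢
      simp [hx, hy]
    have hlab : ∀ c : List (Fin (d+1) → ℝ) →₀ ZMod 2, ∀ i : Fin (d+1), ∀ n,
        c ∈ Sup (fun l' => ∀ x ∈ l', x ∈ stdSimplex ℝ (Fin (d+1)) ∩ {x | x i = 0}) →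
        (SD bary n)^[N] c ∈ Sup (fun l' => ∀ x ∈ l',
          x ∈ stdSimplex ℝ (Fin (d+1)) ∩ {x | x i = 0}) :=
      fun c i n hc => SD_hull (hconv i) n N c hc
    have hstep : (SD bary (k+1))^[N] (Finsupp.single (vl d (k+1)) 1) ∈
        Sup (fun l => ∀ x ∈ l, ℓ x ≤ k) := by
      rw [mem_Sup]
      intro l hl x hx
      by_contra hcon
      push Not at hcon
      have hx0 : x ∈ stdSimplex ℝ (Fin (d+1)) :=
        mem_Sup.1 (SD_hull (convex_stdSimplex ℝ (Fin (d+1))) (k+1) N _ (single_mem_Sup (by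
          intro y hy
          obtain ⟨i, hi, rfl⟩ := mem_vl hy
          exact hstd i (by omega)))) l hl x hx
      obtain ⟨i, hi, hpos⟩ := hℓ x hx0
      have := mem_Sup.1 (hlab _ i (k+1) (single_mem_Sup (l := vl d (k+1)) (by
          intro y hy
          obtain ⟨j, hj, rfl⟩ := mem_vl hy
          refine ⟨hstd j (by omega), ?_⟩
          simp only [Set.mem_setOf_eq]
          rw [if_neg (by omega)]))) l hl x hx
      have h0 : x i = 0 := this.2
      linarith
    rw [NN_step ℓ k _ hstep, BD_SD_iter, BD_single, vl, bdl_cons]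
    rw [← Module.End.pow_apply, map_add, map_add, Module.End.pow_apply, ih]
    suffices h : ∀ c : List (Fin (d+1) → ℝ) →₀ ZMod 2,
        c ∈ Sup (fun l' => ∃ i : Fin (d+1), (i : ℕ) < k ∧
          ∀ x ∈ l', x ∈ stdSimplex ℝ (Fin (d+1)) ∩ {x | x i = 0}) →
        NN ℓ (Multiset.range k) ((SD bary k ^ N) c) = 0 by
      rw [h, add_zero]
      apply cone_mem _ _ (bdl_mem (vl d k))
      rintro l' ⟨_, h2, h3⟩
      obtain ⟨y, hy, hyl⟩ := h3 (vl_nodup d k (by omega))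
      obtain ⟨i, hi, rfl⟩ := mem_vl hy
      refine ⟨⟨i, by omega⟩, hi, ?_⟩
      intro x hx
      rcases List.mem_cons.1 hx with rfl | hx
      · refine ⟨hstd k (by omega), ?_⟩
        simp only [Set.mem_setOf_eq]
        rw [if_neg (by omega)]
      · obtain ⟨j, hj, rfl⟩ := mem_vl (h2 x hx)
        refine ⟨hstd j (by omega), ?_⟩
        simp only [Set.mem_setOf_eq]
        rw [if_neg]
        rintro rfl
        exact hyl hx
    intro c hc
    have hlin : NN ℓ (Multiset.range k) ((SD bary k ^ N) c) =
        Finsupp.linearCombination (ZMod 2)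
          (fun l => NN ℓ (Multiset.range k) ((SD bary k ^ N) (Finsupp.single l 1))) c := by
      have : NN ℓ (Multiset.range k) ∘ₗ (SD bary k ^ N) =
        Finsupp.linearCombination (ZMod 2)
          (fun l => NN ℓ (Multiset.range k) ((SD bary k ^ N) (Finsupp.single l 1))) := by
        apply chain_ext; intro l; simp
      exact congrArg (fun f => f c) this
    rw [hlin]
    have := linComb_mem (⊥ : Submodule (ZMod 2) (ZMod 2))
      (fun l => NN ℓ (Multiset.range k) ((SD bary k ^ N) (Finsupp.single l 1))) ?_ hc
    · simpa using this
    · rintro l ⟨i, hi, hl⟩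
      rw [Submodule.mem_bot, Module.End.pow_apply]
      apply NN_zero_of ℓ _ i (Multiset.mem_range.2 hi)
      have := hlab _ i k (single_mem_Sup (l := l) hl)
      rw [mem_Sup] at this ⊢
      intro l' hl' x hx he
      obtain ⟨h1, h2⟩ := this l' hl' x hx
      obtain ⟨j, hj, hpos⟩ := hℓ x h1
      have : i = j := Fin.ext (he ▸ hj)
      subst this
      exact absurd h2 hpos.ne'

lemma brouwer_approx (d : ℕ) (f : (Fin (d+1) → ℝ) → (Fin (d+1) → ℝ))
    (hf : Set.MapsTo f (stdSimplex ℝ (Fin (d+1))) (stdSimplex ℝ (Fin (d+1)))) (N : ℕ) :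
    ∃ y : Fin (d+1) → (Fin (d+1) → ℝ), (∀ i, y i ∈ stdSimplex ℝ (Fin (d+1))) ∧
      (∀ i, f (y i) i ≤ y i i) ∧
      ∀ i j, dist (y i) (y j) ≤ (1 - 1 / ((d : ℝ) + 1)) ^ N := by
  classical
  have hex : ∀ x ∈ stdSimplex ℝ (Fin (d+1)), ∃ i : Fin (d+1), 0 < x i ∧ f x i ≤ x i := by
    intro x hx
    by_contra hcon
    push Not at hcon
    have h1 := (hf hx).2
    have h2 := hx.2
    have hle : ∀ i, x i ≤ f x i := by
      intro i
      rcases (hx.1 i).lt_or_eq with h | h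
      · exact (hcon i h).le
      · rw [← h]; exact (hf hx).1 i
    obtain ⟨i, hi⟩ : ∃ i, 0 < x i := by
      by_contra h
      push Not at h
      have : ∑ i, x i ≤ 0 := Finset.sum_nonpos (fun i _ => h i)
      linarith
    have : ∑ i, x i < ∑ i, f x i :=
      Finset.sum_lt_sum (fun i _ => hle i) ⟨i, Finset.mem_univ _, hcon i hi⟩
    linarith
  let ℓ : (Fin (d+1) → ℝ) → ℕ := fun x =>
    if h : ∃ i : Fin (d+1), 0 < x i ∧ f x i ≤ x i then ((h.choose : Fin (d+1)) : ℕ) else 0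
  have hℓ : ∀ x ∈ stdSimplex ℝ (Fin (d+1)), ∃ i : Fin (d+1), ℓ x = i ∧ 0 < x i ∧ f x i ≤ x i := by
    intro x hx
    refine ⟨(hex x hx).choose, ?_, (hex x hx).choose_spec⟩
    simp only [ℓ, dif_pos (hex x hx)]
  have hS := sperner d N ℓ (fun x hx => by
    obtain ⟨i, h1, h2, _⟩ := hℓ x hx; exact ⟨i, h1, h2⟩) (d+1) le_rfl
  set c := (SD bary (d+1))^[N] (Finsupp.single (vl d (d+1)) (1 : ZMod 2)) with hc
  have hvl : ∀ x ∈ vl d (d+1), x ∈ stdSimplex ℝ (Fin (d+1)) := by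
    intro y hy
    obtain ⟨i, hi, rfl⟩ := mem_vl hy
    refine ⟨fun m => by dsimp only; split_ifs <;> norm_num, ?_⟩
    rw [Finset.sum_eq_single ⟨i, hi⟩]
    · simp
    · intro b _ hb
      rw [if_neg]
      intro h
      exact hb (Fin.ext h)
    · simp
  have hull := mem_Sup.1 (SD_hull (convex_stdSimplex ℝ (Fin (d+1))) (d+1) N _ (single_mem_Sup hvl))
  have hmesh := mem_Sup.1 (SD_mesh (1 - 1 / ((d : ℝ) + 1)) 1 zero_le_one (d+1) (by
      intro m hm
      have hm' : (m : ℝ) ≤ d + 1 := by exact_mod_cast hm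
      have : (m : ℝ) / (d + 1) ≤ 1 := by rw [div_le_one (by positivity)]; exact hm'
      have e : (1 - 1 / ((d : ℝ) + 1)) * m = m - m / (d + 1) := by ring
      linarith) (by
      have : 1 / ((d : ℝ) + 1) ≤ 1 := by rw [div_le_one (by positivity)]; linarith [(Nat.cast_nonneg d : (0:ℝ) ≤ d)]
      linarith) N (vl d (d+1)) (vl_length _ _) (by
      intro x hx y hy
      obtain ⟨i, hi, rfl⟩ := mem_vl hx
      obtain ⟨j, hj, rfl⟩ := mem_vl hy
      rw [dist_pi_le_iff zero_le_one]
      intro m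
      split_ifs <;> simp))
  rw [← hc] at hull hmesh
  obtain ⟨l, hl, hperm⟩ : ∃ l ∈ c.support, ((l.map ℓ : List ℕ) : Multiset ℕ) = Multiset.range (d+1) := by
    by_contra hcon
    push Not at hcon
    have : NN ℓ (Multiset.range (d+1)) c = 0 := by
      rw [NN, Finsupp.linearCombination_apply]
      apply Finset.sum_eq_zero
      intro l hl
      simp only [hcon l hl, if_false, smul_zero]
    rw [this] at hS
    exact absurd hS (by decide)
  have hpt : ∀ i : Fin (d+1), ∃ x ∈ l, ℓ x = i := by
    intro i
    have : (i : ℕ) ∈ Multiset.range (d+1) := Multiset.mem_range.2 i.2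
    rw [← hperm] at this
    simpa using this
  choose y hy hyl using hpt
  refine ⟨y, fun i => hull l hl _ (hy i), ?_, ?_⟩
  · intro i
    obtain ⟨j, h1, h2, h3⟩ := hℓ (y i) (hull l hl _ (hy i))
    have : i = j := Fin.ext ((hyl i).symm.trans h1)
    subst this
    exact h3
  · intro i j
    simpa using (hmesh l hl).2 _ (hy i) _ (hy j)

theorem brouwer_simplex (d : ℕ) (f : (Fin (d+1) → ℝ) → (Fin (d+1) → ℝ))
    (hf : Set.MapsTo f (stdSimplex ℝ (Fin (d+1))) (stdSimplex ℝ (Fin (d+1))))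
    (hc : ContinuousOn f (stdSimplex ℝ (Fin (d+1)))) :
    ∃ x ∈ stdSimplex ℝ (Fin (d+1)), f x = x := by
  choose y hy1 hy2 hy3 using brouwer_approx d f hf
  obtain ⟨x, hx, φ, hφ, hlim⟩ := (isCompact_stdSimplex ℝ (Fin (d+1))).tendsto_subseq
    (fun n => hy1 n 0)
  have hr0 : 0 ≤ 1 - 1 / ((d : ℝ) + 1) := by
    have : 1 / ((d : ℝ) + 1) ≤ 1 := by
      rw [div_le_one (by positivity)]; linarith [(Nat.cast_nonneg d : (0:ℝ) ≤ d)]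
    linarith
  have hr1 : 1 - 1 / ((d : ℝ) + 1) < 1 := by
    have : 0 < 1 / ((d : ℝ) + 1) := by positivity
    linarith
  have hpow := (tendsto_pow_atTop_nhds_zero_of_lt_one hr0 hr1).comp hφ.tendsto_atTop
  have hlim' : ∀ i, Filter.Tendsto (fun n => y (φ n) i) Filter.atTop (nhds x) := by
    intro i
    have hd : Filter.Tendsto (fun n => dist (y (φ n) 0) (y (φ n) i)) Filter.atTop (nhds 0) :=
      squeeze_zero (fun _ => dist_nonneg) (fun n => hy3 (φ n) 0 i) hpow
    exact (tendsto_iff_of_dist hd).1 hlim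
  refine ⟨x, hx, ?_⟩
  have hle : ∀ i, f x i ≤ x i := by
    intro i
    have h1 : Filter.Tendsto (fun n => f (y (φ n) i)) Filter.atTop (nhds (f x)) := by
      have := (hc x hx).tendsto
      apply this.comp
      rw [tendsto_nhdsWithin_iff]
      exact ⟨hlim' i, Filter.Eventually.of_forall (fun n => hy1 _ _)⟩
    have h1' := ((continuous_apply i).tendsto _).comp h1
    have h2' := ((continuous_apply i).tendsto _).comp (hlim' i)
    exact le_of_tendsto_of_tendsto' h1' h2' (fun n => hy2 (φ n) i)
  funext i
  have h := (Finset.sum_eq_sum_iff_of_le (fun i (_ : i ∈ Finset.univ) => hle i)).1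
    ((hf hx).2.trans hx.2.symm)
  exact h i (Finset.mem_univ _)

end Brouwer
end PachAux

namespace PachAux
open Finset

section Selection

lemma brouwer_box (d : ℕ) (R : ℝ) (hR : 0 < R) (g : (Fin d → ℝ) → (Fin d → ℝ))
    (hc : Continuous g) (hg : ∀ p i, |g p i| ≤ R) : ∃ p, g p = p := by
  set S : ℝ := 2 * R * (d + 1) with hS
  have hSpos : 0 < S := by positivity
  let A : (Fin (d+1) → ℝ) → (Fin d → ℝ) := fun w i => S * w i.succ - R
  let B : (Fin d → ℝ) → (Fin (d+1) → ℝ) := fun y =>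
    Fin.cons (1 - ∑ i, (y i + R) / S) (fun i => (y i + R) / S)
  have hA : Continuous A := by fun_prop
  have hB : Continuous B := by
    refine continuous_pi fun i => ?_
    refine Fin.cases ?_ (fun j => ?_) i
    · simp only [B, Fin.cons_zero]; fun_prop
    · simp only [B, Fin.cons_succ]; fun_prop
  have hAB : ∀ y, A (B y) = y := by
    intro y; ext i
    simp only [A, B, Fin.cons_succ]
    field_simp; ring
  obtain ⟨x, -, hx⟩ := brouwer_simplex d (fun w => B (g (A w))) (by
    intro w _
    constructor
    · intro i
      refine Fin.cases ?_ (fun j => ?_) i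
      · simp only [B, Fin.cons_zero]
        have : ∑ i, (g (A w) i + R) / S ≤ ∑ i : Fin d, (2 * R) / S := by
          refine Finset.sum_le_sum fun i _ => ?_
          have := (abs_le.1 (hg (A w) i)).2
          gcongr; linarith
        have h2 : ∑ i : Fin d, (2 * R) / S ≤ 1 := by
          rw [Finset.sum_const, Finset.card_univ, Fintype.card_fin, nsmul_eq_mul, ← mul_div_assoc,
            div_le_one hSpos]
          rw [hS]; nlinarith
        linarith
      · simp only [B, Fin.cons_succ]
        have := (abs_le.1 (hg (A w) j)).1
        exact div_nonneg (by linarith) hSpos.le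
    · rw [Fin.sum_univ_succ]; simp [B]) ((hB.comp (hc.comp hA)).continuousOn)
  refine ⟨A x, ?_⟩
  have := congrArg A hx
  simpa [hAB] using this

lemma card_update {n : ℕ} {W : Type*} [DecidableEq W] (X : Fin n → Finset W) (k : Fin n)
    (g : (Fin n → W) → Prop) [DecidablePred g] :
    ∑ y ∈ X k, #{x ∈ Fintype.piFinset X | g (Function.update x k y)} =
      #(X k) * #{x ∈ Fintype.piFinset X | g x} := by
  have h1 : ∑ y ∈ X k, #{x ∈ Fintype.piFinset X | g (Function.update x k y)} =
      ∑ q ∈ X k ×ˢ Fintype.piFinset X, if g (Function.update q.2 k q.1) then 1 else 0 := by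
    rw [Finset.sum_product]
    refine Finset.sum_congr rfl fun y _ => ?_
    rw [Finset.card_filter]
  have h2 : #(X k) * #{x ∈ Fintype.piFinset X | g x} =
      ∑ q ∈ X k ×ˢ Fintype.piFinset X, if g q.2 then 1 else 0 := by
    rw [Finset.sum_product, Finset.card_filter]
    simp
  rw [h1, h2]
  refine Finset.sum_nbij' (fun q => (q.2 k, Function.update q.2 k q.1))
    (fun q => (q.2 k, Function.update q.2 k q.1)) ?_ ?_ ?_ ?_ ?_
  · rintro ⟨y, x⟩ h
    simp only [Finset.mem_product, Fintype.mem_piFinset] at h ⊢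
    refine ⟨h.2 k, fun j => ?_⟩
    by_cases hj : j = k
    · subst hj; simpa using h.1
    · simpa [hj] using h.2 j
  · rintro ⟨y, x⟩ h
    simp only [Finset.mem_product, Fintype.mem_piFinset] at h ⊢
    refine ⟨h.2 k, fun j => ?_⟩
    by_cases hj : j = k
    · subst hj; simpa using h.1
    · simpa [hj] using h.2 j
  · rintro ⟨y, x⟩ h; simp
  · rintro ⟨y, x⟩ h; simp
  · rintro ⟨y, x⟩ h; simp

set_option maxHeartbeats 1000000 in
open Classical in
/-- derandomised layer by layer choice -/
lemma layer_choice {n : ℕ} {W Λ U : Type*} (X : Fin n → Finset W)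
    (hX : ∀ i, (X i).Nonempty) (col : Λ → Fin n) (near : U → (Fin n → Λ) → Prop)
    (hnear : ∀ u c, near u c → ∀ j, col (c j) = j)
    (m : ℕ) (hm : 0 < m)
    (hfin : ∀ k w, ∃ P : Finset (U × (Fin n → Λ)), #P ≤ m ∧ ∀ u c, near u c → c k = w → (u, c) ∈ P)
    (Bad : U → (Fin n → W) → Prop)
    (hBad : ∀ u, (#{x ∈ Fintype.piFinset X | Bad u x} : ℝ) * m ^ n < ∏ i, (#(X i) : ℝ)) :
    ∃ a : Λ → W, (∀ z, a z ∈ X (col z)) ∧ ∀ u c, near u c → ¬ Bad u (fun j => a (c j)) := by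
  set T : ℝ := ∏ i, (#(X i) : ℝ)
  have key : ∀ k, k ≤ n → ∃ a : Λ → W, (∀ z, a z ∈ X (col z)) ∧ ∀ u c, near u c →
      (#{x ∈ Fintype.piFinset X | Bad u (fun j => if (j : ℕ) < k then a (c j) else x j)} : ℝ)
        * m ^ n < m ^ k * T := by
    intro k
    induction k with
    | zero =>
      intro _
      choose a0 ha0 using hX
      exact ⟨fun z => a0 (col z), fun z => ha0 _, fun u c _ => by simpa using hBad u⟩
    | succ k ih =>
      intro hk
      obtain ⟨a, haX, ha⟩ := ih (by omega)
      let K : Fin n := ⟨k, by omega⟩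
      have hy : ∀ w, ∃ y ∈ X K, ∀ u c, near u c → c K = w →
          (#{x ∈ Fintype.piFinset X | Bad u (fun j => if (j : ℕ) < k then a (c j) else
            Function.update x K y j)} : ℝ) * m ^ n < m ^ (k+1) * T := by
        intro w
        by_contra hcon
        push Not at hcon
        obtain ⟨P0, hP0, hP0'⟩ := hfin K w
        let P := P0.filter (fun q => near q.1 q.2)
        have hP : #P ≤ m := (Finset.card_filter_le _ _).trans hP0
        let N : W → U × (Fin n → Λ) → ℕ := fun y q =>
          #{x ∈ Fintype.piFinset X | Bad q.1 (fun j => if (j : ℕ) < k then a (q.2 j) else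
            Function.update x K y j)}
        have h1 : ∀ y ∈ X K, m ^ (k+1) * T ≤ ∑ q ∈ P, (N y q : ℝ) * m ^ n := by
          intro y hy
          obtain ⟨u, c, hn, hc, h⟩ := hcon y hy
          have hmem : (u, c) ∈ P := by
            simp only [P, Finset.mem_filter]; exact ⟨hP0' u c hn hc, hn⟩
          have hs : (N y (u, c) : ℝ) * m ^ n ≤ ∑ q ∈ P, (N y q : ℝ) * m ^ n :=
            Finset.single_le_sum (f := fun q => (N y q : ℝ) * m ^ n)
              (fun q _ => mul_nonneg (Nat.cast_nonneg _) (pow_nonneg (Nat.cast_nonneg _) _)) hmem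
          exact le_trans h hs
        obtain ⟨y0, hy0⟩ := hX K
        have hPne : P.Nonempty := by
          obtain ⟨u, c, hn, hc, h⟩ := hcon y0 hy0
          exact ⟨(u, c), by simp only [P, Finset.mem_filter]; exact ⟨hP0' u c hn hc, hn⟩⟩
        have h2 : ∀ q ∈ P, ∑ y ∈ X K, (N y q : ℝ) * m ^ n < #(X K) * (m ^ k * T) := by
          intro q hq
          have hq2 : near q.1 q.2 := (Finset.mem_filter.1 hq).2
          have := card_update X K (fun x => Bad q.1 (fun j => if (j : ℕ) < k then a (q.2 j) else x j))
          rw [← Finset.sum_mul]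
          have h3 : ∑ y ∈ X K, (N y q : ℝ) = #(X K) *
            #{x ∈ Fintype.piFinset X | Bad q.1 (fun j => if (j : ℕ) < k then a (q.2 j) else x j)} := by
            exact_mod_cast this
          rw [h3, mul_assoc]
          have hpos : (0:ℝ) < #(X K) := by exact_mod_cast Finset.card_pos.2 ⟨y0, hy0⟩
          exact mul_lt_mul_of_pos_left (ha q.1 q.2 hq2) hpos
        have h4 : #(X K) * (m ^ (k+1) * T) ≤ ∑ y ∈ X K, ∑ q ∈ P, (N y q : ℝ) * m ^ n := by
          have := Finset.sum_le_sum h1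
          simpa using this
        rw [Finset.sum_comm] at h4
        have h5 := Finset.sum_lt_sum_of_nonempty hPne h2
        rw [Finset.sum_const, nsmul_eq_mul] at h5
        have hTpos : 0 ≤ T := Finset.prod_nonneg fun i _ => by positivity
        have h6 : (#P : ℝ) * (#(X K) * (m ^ k * T)) ≤ m * (#(X K) * (m ^ k * T)) := by
          have : (#P : ℝ) ≤ m := by exact_mod_cast hP
          exact mul_le_mul_of_nonneg_right this
            (mul_nonneg (Nat.cast_nonneg _) (mul_nonneg (pow_nonneg (Nat.cast_nonneg _) _) hTpos))
        have : (m : ℝ) * (#(X K) * (m ^ k * T)) = #(X K) * (m ^ (k+1) * T) := by ring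
        linarith
      choose y hyX hy using hy
      refine ⟨fun z => if col z = K then y z else a z, ?_, ?_⟩
      · intro z
        by_cases h : col z = K
        · simp only [h, if_true]; exact hyX z
        · simp only [h, if_false]; exact haX z
      · intro u c hn
        have := hy (c K) u c hn rfl
        have hfun : ∀ x : Fin n → W, (fun j : Fin n => if (j : ℕ) < k + 1 then
            (if col (c j) = K then y (c j) else a (c j)) else x j) =
            (fun j : Fin n => if (j : ℕ) < k then a (c j) else Function.update x K (y (c K)) j) := by
          intro x
          funext j
          have hcol := hnear u c hn
          rw [hcol j]
          by_cases hj : j = K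
          · subst hj; simp [K]
          · have hjk : (j : ℕ) ≠ k := fun h => hj (Fin.ext h)
            simp only [hj, if_false, Function.update_of_ne hj]
            by_cases h : (j : ℕ) < k
            · simp [h, Nat.lt_succ_of_lt h]
            · have : ¬ (j : ℕ) < k + 1 := by omega
              simp [h, this]
        simp only [hfun]
        exact this
  obtain ⟨a, haX, ha⟩ := key n le_rfl
  refine ⟨a, haX, fun u c hn hb => ?_⟩
  have := ha u c hn
  simp only [Fin.is_lt, if_true] at this
  rw [Finset.filter_true_of_mem (fun _ _ => hb), Fintype.card_piFinset] at this
  push_cast at this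
  rw [mul_comm] at this
  exact lt_irrefl _ this

end Selection
end PachAux

namespace PachAux
open Finset

section Lattice

open Classical in
/-- number of odd coordinates -/
noncomputable def dimz {d : ℕ} (z : Fin d → ℤ) : Fin (d+1) :=
  ⟨#{i | Odd (z i)}, Nat.lt_succ_of_le ((Finset.card_le_univ _).trans (by simp))⟩

lemma exists_neighbor {d : ℕ} (u : Fin d → ℤ) (j : Fin (d+1)) :
    ∃ z : Fin d → ℤ, dimz z = j ∧ ∀ i, |z i - u i| ≤ 1 := by
  classical
  obtain ⟨O, -, hO⟩ := Finset.exists_subset_card_eq (s := (Finset.univ : Finset (Fin d))) (n := j)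
    (by have := j.2; simp; omega)
  refine ⟨fun i => if (i ∈ O ↔ Odd (u i)) then u i else u i + 1, ?_, ?_⟩
  · apply Fin.ext
    simp only [dimz]
    rw [← hO]
    congr 1
    ext i
    simp only [Finset.mem_filter, Finset.mem_univ, true_and]
    by_cases h1 : i ∈ O <;> by_cases h2 : Odd (u i) <;> simp [h1, h2, Int.odd_add] <;> simpa using h2
  · intro i
    dsimp only
    split_ifs <;> simp

/-- open star-like sets -/
def UU {d : ℕ} (h : ℝ) (z : Fin d → ℤ) : Set (Fin d → ℝ) :=
  {p | ∃ s : ℝ, 0 < s ∧ s < 1 ∧ ∀ i, (Even (z i) → |p i / h - z i| < s) ∧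
    (Odd (z i) → |p i / h - z i| < 1 - s)}

lemma UU_open {d : ℕ} (h : ℝ) (z : Fin d → ℤ) : IsOpen (UU h z) := by
  have : UU h z = ⋃ s ∈ Set.Ioo (0:ℝ) 1, ⋂ i, {p : Fin d → ℝ | (Even (z i) → |p i / h - z i| < s) ∧
    (Odd (z i) → |p i / h - z i| < 1 - s)} := by
    ext p; simp [UU, and_assoc]
  rw [this]
  refine isOpen_biUnion fun s _ => isOpen_iInter_of_finite fun i => ?_
  rcases Int.even_or_odd (z i) with he | ho
  · have : ¬ Odd (z i) := Int.not_odd_iff_even.2 he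
    simp only [he, this, forall_true_left, false_imp_iff, and_true]
    exact isOpen_lt (by fun_prop) (by fun_prop)
  · have : ¬ Even (z i) := Int.not_even_iff_odd.2 ho
    simp only [ho, this, forall_true_left, false_imp_iff, true_and]
    exact isOpen_lt (by fun_prop) (by fun_prop)

lemma UU_cover {d : ℕ} (h : ℝ) : (Set.univ : Set (Fin d → ℝ)) ⊆ ⋃ z, UU h z := by
  intro p _
  let e : Fin d → ℤ := fun i => 2 * round (p i / h / 2)
  let t : Fin d → ℝ := fun i => |p i / h - e i|
  have ht : ∀ i, t i ≤ 1 := by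
    intro i
    have := abs_sub_round (p i / h / 2)
    simp only [t, e]; push_cast
    rw [abs_le] at *
    constructor <;> linarith [this.1, this.2]
  obtain ⟨s, hs, hst⟩ := (Set.Ioo_infinite (zero_lt_one' ℝ)).exists_notMem_finset (Finset.univ.image t)
  have hst' : ∀ i, t i ≠ s := fun i hi => hst (Finset.mem_image.2 ⟨i, Finset.mem_univ _, hi⟩)
  have he : ∀ i, Even (e i) := fun i => even_two_mul _
  rw [Set.mem_iUnion]
  refine ⟨fun i => if t i < s then e i else if (e i : ℝ) ≤ p i / h then e i + 1 else e i - 1,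
    s, hs.1, hs.2, fun i => ?_⟩
  dsimp only
  by_cases h1 : t i < s
  · rw [if_pos h1]
    exact ⟨fun _ => h1, fun ho => absurd (he i) (Int.not_even_iff_odd.2 ho)⟩
  · have h2 : s < t i := lt_of_le_of_ne (not_lt.1 h1) (hst' i).symm
    have h3 := ht i
    rw [if_neg h1]
    by_cases h4 : (e i : ℝ) ≤ p i / h
    · rw [if_pos h4]
      refine ⟨fun ho => absurd ho (Int.not_even_iff_odd.2 (he i).add_one), fun _ => ?_⟩
      simp only [t] at h2 h3
      rw [abs_of_nonneg (by linarith)] at h2 h3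
      push_cast
      rw [abs_lt]; constructor <;> linarith
    · rw [if_neg h4]
      refine ⟨fun ho => absurd ho (Int.not_even_iff_odd.2 ((he i).sub_odd odd_one)), fun _ => ?_⟩
      simp only [t] at h2 h3
      push Not at h4
      rw [abs_of_neg (by linarith)] at h2 h3
      push_cast
      rw [abs_lt]; constructor <;> linarith

lemma UU_lt_one {d : ℕ} {h : ℝ} {z : Fin d → ℤ} {p : Fin d → ℝ} (hp : p ∈ UU h z) (i : Fin d) :
    |p i / h - z i| < 1 := by
  obtain ⟨s, h0, h1, hs⟩ := hp
  rcases Int.even_or_odd (z i) with he | ho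
  · exact ((hs i).1 he).trans h1
  · exact ((hs i).2 ho).trans (by linarith)

lemma UU_near {d : ℕ} {h : ℝ} {z z' : Fin d → ℤ} {p : Fin d → ℝ} (hp : p ∈ UU h z)
    (hp' : p ∈ UU h z') (i : Fin d) : |z i - z' i| ≤ 1 := by
  have h1 := abs_lt.1 (UU_lt_one hp i)
  have h2 := abs_lt.1 (UU_lt_one hp' i)
  have h3 : ((z i - z' i : ℤ) : ℝ) < (2 : ℤ) := by push_cast; linarith [h1.1, h2.2]
  have h4 : ((-2 : ℤ) : ℝ) < (z i - z' i : ℤ) := by push_cast; linarith [h1.2, h2.1]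
  rw [Int.cast_lt] at h3 h4
  rw [abs_le]; constructor <;> omega

lemma UU_inj {d : ℕ} {h : ℝ} {z z' : Fin d → ℤ} {p : Fin d → ℝ} (hp : p ∈ UU h z)
    (hp' : p ∈ UU h z') (hd : dimz z = dimz z') : z = z' := by
  classical
  have hnear := UU_near hp hp'
  have key : ∀ {z z' : Fin d → ℤ} {s s' : ℝ}, (∀ i, (Even (z i) → |p i / h - z i| < s) ∧
    (Odd (z i) → |p i / h - z i| < 1 - s)) → (∀ i, (Even (z' i) → |p i / h - z' i| < s') ∧
    (Odd (z' i) → |p i / h - z' i| < 1 - s')) → s ≤ s' → ∀ i, Odd (z' i) → Odd (z i) := by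
    intro z z' s s' hs hs' hle i ho
    by_contra hne
    rw [Int.not_odd_iff_even] at hne
    have h1 := abs_lt.1 ((hs i).1 hne)
    have h2 := abs_lt.1 ((hs' i).2 ho)
    have h3 : ((z i - z' i : ℤ) : ℝ) < (1 : ℤ) := by push_cast; linarith [h1.1, h2.2]
    have h4 : ((-1 : ℤ) : ℝ) < (z i - z' i : ℤ) := by push_cast; linarith [h1.2, h2.1]
    rw [Int.cast_lt] at h3 h4
    have h5 : z i = z' i := by omega
    rw [h5] at hne
    exact absurd hne (Int.not_even_iff_odd.2 ho)
  obtain ⟨s, -, -, hs⟩ := hp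
  obtain ⟨s', -, -, hs'⟩ := hp'
  have hd' : #{i | Odd (z i)} = #{i | Odd (z' i)} := congrArg Fin.val hd
  have hpar : ∀ i, Odd (z i) ↔ Odd (z' i) := by
    have : (Finset.univ.filter fun i => Odd (z i)) = (Finset.univ.filter fun i => Odd (z' i)) := by
      rcases le_total s s' with hl | hl
      · refine (Finset.eq_of_subset_of_card_le ?_ hd'.le).symm
        intro i hi
        simp only [Finset.mem_filter, Finset.mem_univ, true_and] at hi ⊢
        exact key hs hs' hl i hi
      · refine Finset.eq_of_subset_of_card_le ?_ hd'.ge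
        intro i hi
        simp only [Finset.mem_filter, Finset.mem_univ, true_and] at hi ⊢
        exact key hs' hs hl i hi
    intro i
    have := congrArg (i ∈ ·) this
    simpa using this
  funext i
  have h1 := abs_le.1 (hnear i)
  have h2 := hpar i
  rw [Int.odd_iff, Int.odd_iff] at h2
  omega

end Lattice

section Sel

open Classical in
lemma uniform_radius {n : ℕ} {W : Type*} [NormedAddCommGroup W] [NormedSpace ℝ W]
    [ProperSpace W]
    (X : Fin n → Finset W) (B : ℝ) (hB : 0 < B)
    (hq : ∀ q, (#{x ∈ Fintype.piFinset X | q ∈ convexHull ℝ (Set.range x)} : ℝ) < B) :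
    ∃ ρ > 0, ∀ p, (#{x ∈ Fintype.piFinset X |
      (convexHull ℝ (Set.range x) ∩ Metric.closedBall p ρ).Nonempty} : ℝ) < B := by
  have h1 : ∀ p, ∃ r > 0, ∀ x ∈ Fintype.piFinset X, p ∉ convexHull ℝ (Set.range x) →
      Disjoint (convexHull ℝ (Set.range x)) (Metric.ball p r) := by
    intro p
    have : ∀ x : Fin n → W, ∃ r > 0, p ∉ convexHull ℝ (Set.range x) →
      Disjoint (convexHull ℝ (Set.range x)) (Metric.ball p r) := by
      intro x
      by_cases hp : p ∈ convexHull ℝ (Set.range x)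
      · exact ⟨1, one_pos, fun h => absurd hp h⟩
      · have hcl : IsClosed (convexHull ℝ (Set.range x)) :=
          ((Set.finite_range x).isCompact_convexHull ℝ).isClosed
        obtain ⟨r, hr, hr'⟩ := Metric.isOpen_iff.1 hcl.isOpen_compl p hp
        exact ⟨r, hr, fun _ => (Set.disjoint_left.2 fun y hy hy' => hr' hy' hy)⟩
    choose r hr hr' using this
    by_cases hne : (Fintype.piFinset X).Nonempty
    · obtain ⟨x0, -, hx0⟩ := Finset.exists_min_image _ r hne
      exact ⟨r x0, hr x0, fun x hx hp => (hr' x hp).mono_right (Metric.ball_subset_ball (hx0 x hx))⟩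
    · rw [Finset.not_nonempty_iff_eq_empty] at hne
      exact ⟨1, one_pos, fun x hx => by simp [hne] at hx⟩
  choose r hr hr' using h1
  let K : Set W := ⋃ x ∈ Fintype.piFinset X, convexHull ℝ (Set.range x)
  have hK : IsCompact K := by
    refine (Fintype.piFinset X).isCompact_biUnion fun x _ =>
      ((Set.finite_range x).isCompact_convexHull ℝ)
  obtain ⟨δ, hδ, hδ'⟩ := lebesgue_number_lemma_of_metric (c := fun p : W => Metric.ball p (r p)) hK
    (fun p => Metric.isOpen_ball) (fun p _ => Set.mem_iUnion.2 ⟨p, Metric.mem_ball_self (hr p)⟩)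
  refine ⟨δ / 3, by positivity, fun p => ?_⟩
  by_cases hne : ({x ∈ Fintype.piFinset X |
      (convexHull ℝ (Set.range x) ∩ Metric.closedBall p (δ/3)).Nonempty}).Nonempty
  · obtain ⟨x0, hx0⟩ := hne
    obtain ⟨hx0, y, hy, hyp⟩ := Finset.mem_filter.1 hx0
    obtain ⟨p', hp'⟩ := hδ' y (Set.mem_biUnion hx0 hy)
    refine lt_of_le_of_lt ?_ (hq p')
    rw [Nat.cast_le]
    refine Finset.card_le_card fun x hx => ?_
    obtain ⟨hx, v, hv, hvp⟩ := Finset.mem_filter.1 hx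
    refine Finset.mem_filter.2 ⟨hx, ?_⟩
    by_contra hcon
    refine Set.disjoint_left.1 (hr' p' x hx hcon) hv (hp' ?_)
    rw [Metric.mem_closedBall] at hyp hvp
    rw [Metric.mem_ball]
    calc dist v y ≤ dist v p + dist p y := dist_triangle _ _ _
      _ ≤ δ/3 + δ/3 := by rw [dist_comm p y]; gcongr
      _ < δ := by linarith
  · rw [Finset.not_nonempty_iff_eq_empty] at hne
    rw [hne]; simpa using hB

open Classical in
theorem selection (d : ℕ) : ∃ ε > (0:ℝ), ∀ X : Fin (d+1) → Finset (Fin d → ℝ),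
    (∀ i, (X i).Nonempty) → ∃ q, ε * ∏ i, (#(X i) : ℝ) ≤
      #{x ∈ Fintype.piFinset X | q ∈ convexHull ℝ (Set.range x)} := by
  set m : ℕ := 3 ^ d * (5 ^ d) ^ (d+1) with hm
  have hmpos : 0 < m := by positivity
  refine ⟨((m:ℝ) ^ (d+1))⁻¹, by positivity, fun X hX => ?_⟩
  by_contra hcon
  push Not at hcon
  have hT : 0 < ∏ i, (#(X i) : ℝ) := Finset.prod_pos fun i _ => by
    exact_mod_cast Finset.card_pos.2 (hX i)
  obtain ⟨ρ, hρ, hball⟩ := uniform_radius X _ (by positivity) hcon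
  let near : (Fin d → ℤ) → (Fin (d+1) → (Fin d → ℤ)) → Prop := fun u c =>
    ∀ j, dimz (c j) = j ∧ ∀ i, |c j i - u i| ≤ 1
  obtain ⟨a, haX, ha⟩ := layer_choice X hX dimz near (fun u c h j => (h j).1) m hmpos (by
    intro k w
    refine ⟨(Finset.Icc (fun i => w i - 1) (fun i => w i + 1)) ×ˢ
      Fintype.piFinset (fun _ => Finset.Icc (fun i => w i - 2) (fun i => w i + 2)), ?_, ?_⟩
    · rw [Finset.card_product, Fintype.card_piFinset]
      simp only [Pi.card_Icc, Int.card_Icc]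
      have h1 : ∀ i, (w i + 1 + 1 - (w i - 1)).toNat = 3 := fun i => by omega
      have h2 : ∀ i, (w i + 2 + 1 - (w i - 2)).toNat = 5 := fun i => by omega
      simp [h1, h2, hm]
    · intro u c hn hc
      simp only [Finset.mem_product, Fintype.mem_piFinset, Finset.mem_Icc, Pi.le_def]
      have hw : ∀ i, |w i - u i| ≤ 1 := by rw [← hc]; exact (hn k).2
      refine ⟨⟨fun i => ?_, fun i => ?_⟩, fun j => ⟨fun i => ?_, fun i => ?_⟩⟩
      · have := abs_le.1 (hw i); omega
      · have := abs_le.1 (hw i); omega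
      · have := abs_le.1 (hw i); have := abs_le.1 ((hn j).2 i); omega
      · have := abs_le.1 (hw i); have := abs_le.1 ((hn j).2 i); omega)
    (fun u x => (convexHull ℝ (Set.range x) ∩
      Metric.closedBall (fun i => ρ * (u i : ℝ)) ρ).Nonempty) (by
    intro u
    have := hball (fun i => ρ * (u i : ℝ))
    have h2 : (0:ℝ) < (m:ℝ) ^ (d+1) := by positivity
    have := mul_lt_mul_of_pos_right this h2
    calc _ < _ := this
      _ = _ := by field_simp)
  obtain ⟨f, hf⟩ := PartitionOfUnity.exists_isSubordinate (isClosed_univ (X := Fin d → ℝ))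
    (fun z => UU ρ z) (fun z => UU_open ρ z) (UU_cover ρ)
  have hsupp : ∀ z p, f z p ≠ 0 → p ∈ UU ρ z := fun z p h => hf z (subset_closure h)
  let g : (Fin d → ℝ) → (Fin d → ℝ) := fun p => ∑ᶠ z, f z p • a z
  have hgc : Continuous g := f.continuous_finsum_smul (g := fun z _ => a z)
    (fun z x hx => continuousAt_const)
  -- bound
  obtain ⟨R, hRpos, hR⟩ : ∃ R > 0, ∀ i, ∀ y ∈ X i, ‖y‖ ≤ R := by
    let s := Finset.univ.biUnion X
    refine ⟨1 + ∑ y ∈ s, ‖y‖, by positivity, fun i y hy => ?_⟩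
    have := Finset.single_le_sum (f := fun y : Fin d → ℝ => ‖y‖) (fun _ _ => norm_nonneg _)
      (Finset.mem_biUnion.2 ⟨i, Finset.mem_univ _, hy⟩ : y ∈ s)
    linarith
  have hgR : ∀ p, g p ∈ Metric.closedBall (0 : Fin d → ℝ) R := by
    intro p
    refine f.finsum_smul_mem_convex (g := fun z _ => a z) (Set.mem_univ p) ?_ (convex_closedBall _ _)
    intro z _
    simpa using hR _ _ (haX z)
  obtain ⟨p, hp⟩ := brouwer_box d R hRpos g hgc (fun p i => by
    have := hgR p
    rw [mem_closedBall_zero_iff] at this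
    exact (norm_le_pi_norm (g p) i).trans this)
  obtain ⟨u, hu⟩ := Set.mem_iUnion.1 (UU_cover ρ (Set.mem_univ p))
  choose nb hnb1 hnb2 using exists_neighbor u
  let c : Fin (d+1) → (Fin d → ℤ) := fun j =>
    if h : ∃ z, p ∈ UU ρ z ∧ dimz z = j then h.choose else nb j
  have hc : near u c := by
    intro j
    simp only [c]
    split_ifs with h
    · exact ⟨h.choose_spec.2, fun i => UU_near h.choose_spec.1 hu i⟩
    · exact ⟨hnb1 j, hnb2 j⟩
  have hcz : ∀ z, p ∈ UU ρ z → c (dimz z) = z := by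
    intro z hz
    have h : ∃ z', p ∈ UU ρ z' ∧ dimz z' = dimz z := ⟨z, hz, rfl⟩
    simp only [c, dif_pos h]
    exact UU_inj h.choose_spec.1 hz h.choose_spec.2
  refine ha u c hc ⟨p, ?_, ?_⟩
  · have : g p ∈ convexHull ℝ (Set.range fun j => a (c j)) := by
      refine f.finsum_smul_mem_convex (g := fun z _ => a z) (Set.mem_univ p) ?_ (convex_convexHull _ _)
      intro z hz
      refine subset_convexHull _ _ ⟨dimz z, ?_⟩
      simp only [hcz z (hsupp z p hz)]
    rwa [hp] at this
  · rw [Metric.mem_closedBall, dist_pi_le_iff hρ.le]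
    intro i
    have := UU_lt_one hu i
    rw [Real.dist_eq]
    have h2 : p i - ρ * (u i : ℝ) = ρ * (p i / ρ - u i) := by field_simp
    rw [h2, abs_mul, abs_of_pos hρ]
    nlinarith

end Sel
end PachAux

namespace PachAux
open Finset

section Net

open Classical in
lemma net_lemma {α Θ : Type*} [Fintype Θ] (Ω : Finset α) (hΩ : Ω.Nonempty) (r b : ℕ)
    (J : Θ → Finset (Fin r)) (hJ : ∀ τ, #(J τ) ≤ b)
    (C : Θ → (Fin r → α) → α → Prop)
    (hC : ∀ τ f f', (∀ t ∈ J τ, f t = f' t) → ∀ ω, C τ f ω ↔ C τ f' ω)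
    (δ : ℝ) (hδ0 : 0 ≤ δ) (hδ1 : δ ≤ 1) (hr : (Fintype.card Θ : ℝ) * (1 - δ) ^ (r - b) < 1) :
    ∃ f : Fin r → α, ∀ τ, (∃ t ∉ J τ, C τ f (f t)) ∨ (#{ω ∈ Ω | C τ f ω} : ℝ) ≤ δ * #Ω := by
  by_contra hcon
  push Not at hcon
  obtain ⟨ω0, hω0⟩ := hΩ
  let T : Finset (Fin r → α) := Fintype.piFinset fun _ => Ω
  let Bad : Θ → Finset (Fin r → α) := fun τ =>
    {f ∈ T | (∀ t ∉ J τ, ¬ C τ f (f t)) ∧ δ * #Ω < (#{ω ∈ Ω | C τ f ω} : ℝ)}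
  have hN : (0:ℝ) < #Ω := by exact_mod_cast Finset.card_pos.2 ⟨ω0, hω0⟩
  have hcover : T ⊆ Finset.univ.biUnion Bad := by
    intro f hf
    obtain ⟨τ, h1, h2⟩ := hcon f
    exact Finset.mem_biUnion.2 ⟨τ, Finset.mem_univ _, Finset.mem_filter.2 ⟨hf, h1, h2⟩⟩
  have hbad : ∀ τ, (#(Bad τ) : ℝ) ≤ (1 - δ) ^ (r - b) * (#Ω : ℝ) ^ r := by
    intro τ
    let π : (Fin r → α) → (Fin r → α) := fun f t => if t ∈ J τ then f t else ω0
    let S : Finset (Fin r → α) := Fintype.piFinset fun t => if t ∈ J τ then Ω else {ω0}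
    have hmaps : ∀ f ∈ Bad τ, π f ∈ S := by
      intro f hf
      have hf1 := (Finset.mem_filter.1 hf).1
      rw [Fintype.mem_piFinset] at hf1 ⊢
      intro t
      by_cases ht : t ∈ J τ
      · simpa [π, ht] using hf1 t
      · simp [π, ht]
    have hJr : #(J τ) ≤ r := by simpa using Finset.card_le_univ (J τ)
    have hScard : #S = #Ω ^ #(J τ) := by
      simp only [S, Fintype.card_piFinset, apply_ite Finset.card, Finset.card_singleton]
      rw [Finset.prod_ite]; simp
    have hfib : ∀ g ∈ S, (#{f ∈ Bad τ | π f = g} : ℝ) ≤ ((1 - δ) * #Ω) ^ (r - #(J τ)) := by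
      intro g _
      by_cases hne : ({f ∈ Bad τ | π f = g}).Nonempty
      · obtain ⟨f0, hf0⟩ := hne
        obtain ⟨hf0, hg⟩ := Finset.mem_filter.1 hf0
        obtain ⟨_, _, hbig⟩ := Finset.mem_filter.1 hf0
        have hCg : ∀ f, π f = g → ∀ ω, C τ f ω ↔ C τ g ω := by
          intro f hf ω
          refine hC τ f g (fun t ht => ?_) ω
          rw [← hf]; simp [π, ht]
        simp only [hCg f0 hg] at hbig
        have hsub : {f ∈ Bad τ | π f = g} ⊆
            Fintype.piFinset fun t => if t ∈ J τ then {g t} else {ω ∈ Ω | ¬ C τ g ω} := by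
          intro f hf
          obtain ⟨hf, hfg⟩ := Finset.mem_filter.1 hf
          obtain ⟨hf1, hf2, _⟩ := Finset.mem_filter.1 hf
          rw [Fintype.mem_piFinset] at hf1 ⊢
          intro t
          by_cases ht : t ∈ J τ
          · rw [if_pos ht, Finset.mem_singleton, ← hfg]; simp [π, ht]
          · rw [if_neg ht, Finset.mem_filter]
            exact ⟨hf1 t, fun h => hf2 t ht ((hCg f hfg _).2 h)⟩
        have h1 := Finset.card_le_card hsub
        have h2 : #(Fintype.piFinset fun t => if t ∈ J τ then {g t} else {ω ∈ Ω | ¬ C τ g ω}) =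
            #{ω ∈ Ω | ¬ C τ g ω} ^ (r - #(J τ)) := by
          simp only [Fintype.card_piFinset, apply_ite Finset.card, Finset.card_singleton]
          rw [Finset.prod_ite]
          simp only [Finset.prod_const_one, one_mul, Finset.prod_const]
          congr 1
          have : (Finset.univ.filter fun t => t ∉ J τ) = (J τ)ᶜ := by ext; simp
          rw [this, Finset.card_compl, Fintype.card_fin]
        rw [h2] at h1
        have h3 : (#{ω ∈ Ω | C τ g ω} : ℝ) + #{ω ∈ Ω | ¬ C τ g ω} = #Ω := by
          exact_mod_cast Finset.card_filter_add_card_filter_not (s := Ω) (fun ω => C τ g ω)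
        calc (#{f ∈ Bad τ | π f = g} : ℝ) ≤ (#{ω ∈ Ω | ¬ C τ g ω} : ℝ) ^ (r - #(J τ)) := by
              exact_mod_cast h1
          _ ≤ _ := by
              gcongr
              linarith
      · rw [Finset.not_nonempty_iff_eq_empty] at hne
        rw [hne]
        have : 0 ≤ 1 - δ := by linarith
        simp only [Finset.card_empty, Nat.cast_zero]
        positivity
    have h1 : (#(Bad τ) : ℝ) = ∑ g ∈ S, (#{f ∈ Bad τ | π f = g} : ℝ) := by
      exact_mod_cast Finset.card_eq_sum_card_fiberwise hmaps
    have h0 : 0 ≤ 1 - δ := by linarith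
    calc (#(Bad τ) : ℝ) ≤ ∑ g ∈ S, ((1 - δ) * #Ω) ^ (r - #(J τ)) := h1 ▸ Finset.sum_le_sum hfib
      _ = (#Ω : ℝ) ^ #(J τ) * ((1 - δ) * #Ω) ^ (r - #(J τ)) := by
          rw [Finset.sum_const, nsmul_eq_mul, hScard]; push_cast; rfl
      _ = (1 - δ) ^ (r - #(J τ)) * (#Ω : ℝ) ^ r := by
          rw [mul_pow, mul_left_comm, ← pow_add]; congr 2; omega
      _ ≤ (1 - δ) ^ (r - b) * (#Ω : ℝ) ^ r := by
          gcongr ?_ * _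
          exact pow_le_pow_of_le_one h0 (by linarith) (by have := hJ τ; omega)
  have hT : (#T : ℝ) = (#Ω : ℝ) ^ r := by simp [T, Fintype.card_piFinset]
  have h1 : (#T : ℝ) ≤ ∑ τ, (#(Bad τ) : ℝ) := by
    exact_mod_cast (Finset.card_le_card hcover).trans Finset.card_biUnion_le
  have h2 := Finset.sum_le_sum fun τ (_ : τ ∈ Finset.univ) => hbad τ
  rw [Finset.sum_const, Finset.card_univ, nsmul_eq_mul] at h2
  rw [hT] at h1
  have h3 : (0:ℝ) < (#Ω : ℝ) ^ r := by positivity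
  nlinarith

end Net

section Geo
variable {d : ℕ}

/-- chosen common zero of `d` affine functionals -/
noncomputable def PZ (g : Fin d → ((Fin d → ℝ) →ᵃ[ℝ] ℝ)) : Fin d → ℝ :=
  Classical.epsilon fun y => ∀ i, g i y = 0

/-- the closed cell of `a` -/
def cell {ι : Type*} (c : ι → ((Fin d → ℝ) →ᵃ[ℝ] ℝ)) (a : Fin d → ℝ) : Set (Fin d → ℝ) :=
  {y | ∀ s, (0 ≤ c s a → 0 ≤ c s y) ∧ (c s a ≤ 0 → c s y ≤ 0)}

lemma aff_add (c : (Fin d → ℝ) →ᵃ[ℝ] ℝ) (v y : Fin d → ℝ) : c (v + y) = c v + c.linear y := by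
  have := c.map_vadd v y
  simpa [add_comm] using this

lemma extreme_eq_PZ {ι : Type*} [Finite ι] (c : ι → ((Fin d → ℝ) →ᵃ[ℝ] ℝ)) (a v : Fin d → ℝ)
    (hv : v ∈ Set.extremePoints ℝ (cell c a)) : ∃ T : Fin d → ι, v = PZ (fun i => c (T i)) := by
  classical
  have := Fintype.ofFinite ι
  obtain ⟨hvQ, hext⟩ := mem_extremePoints.1 hv
  have hker : ∀ y : Fin d → ℝ, (∀ s, c s v = 0 → (c s).linear y = 0) → y = 0 := by
    intro y hy
    have ht : ∃ t > (0:ℝ), ∀ s, c s v ≠ 0 → t * |(c s).linear y| < |c s v| := by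
      have : ∀ s, ∃ t > (0:ℝ), c s v ≠ 0 → ∀ t' ≤ t, t' * |(c s).linear y| < |c s v| := by
        intro s
        by_cases h : c s v = 0
        · exact ⟨1, one_pos, fun h' => absurd h h'⟩
        · have h1 : 0 < |c s v| := abs_pos.2 h
          refine ⟨|c s v| / (|(c s).linear y| + 1), by positivity, fun _ t' ht' => ?_⟩
          have h2 : 0 < |(c s).linear y| + 1 := by positivity
          calc t' * |(c s).linear y| ≤ |c s v| / (|(c s).linear y| + 1) * |(c s).linear y| := by
                gcongr
            _ < |c s v| / (|(c s).linear y| + 1) * (|(c s).linear y| + 1) := by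
                gcongr; linarith
            _ = |c s v| := by field_simp
      choose t ht ht' using this
      by_cases hne : Nonempty ι
      · obtain ⟨s0, -, hs0⟩ := Finset.exists_min_image (Finset.univ : Finset ι) t Finset.univ_nonempty
        exact ⟨t s0, ht s0, fun s hs => ht' s hs _ (hs0 s (Finset.mem_univ _))⟩
      · exact ⟨1, one_pos, fun s => absurd ⟨s⟩ hne⟩
    obtain ⟨t, ht0, ht⟩ := ht
    have hmem : ∀ σ : ℝ, |σ| = 1 → v + (σ * t) • y ∈ cell c a := by
      intro σ hσ s
      rw [aff_add, map_smul, smul_eq_mul]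
      by_cases h : c s v = 0
      · rw [hy s h, h]; simp
      · have h1 := ht s h
        have h2 : |σ * t * (c s).linear y| < |c s v| := by
          rw [abs_mul, abs_mul, hσ, abs_of_pos ht0, one_mul]; exact h1
        have h3 := hvQ s
        have h4 := abs_lt.1 h2
        refine ⟨fun h5 => ?_, fun h5 => ?_⟩
        · have := h3.1 h5
          rw [abs_of_nonneg this] at h4
          linarith [h4.1]
        · have := h3.2 h5
          rw [abs_of_nonpos this] at h4
          linarith [h4.2]
    have h1 := hmem 1 (by simp)
    have h2 := hmem (-1) (by simp)
    have h3 := (hext _ h1 _ h2 ⟨1/2, 1/2, by norm_num, by norm_num, by norm_num, by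
      ext i; simp; ring⟩).1
    have h4 : (1 * t) • y = 0 := by simpa using h3
    rw [one_mul] at h4
    exact (smul_eq_zero.1 h4).resolve_left ht0.ne'
  let S : Set (Module.Dual ℝ (Fin d → ℝ)) := {l | ∃ s, c s v = 0 ∧ (c s).linear = l}
  have hspan : Submodule.span ℝ S = ⊤ := by
    have h1 : (Submodule.span ℝ S).dualCoannihilator = ⊥ := by
      rw [eq_bot_iff]
      intro y hy
      rw [Submodule.mem_dualCoannihilator] at hy
      rw [Submodule.mem_bot]
      exact hker y fun s hs => hy _ (Submodule.subset_span ⟨s, hs, rfl⟩)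
    have h2 := Subspace.dualCoannihilator_dualAnnihilator_eq (W := Submodule.span ℝ S)
    rw [← h2, h1, Submodule.dualAnnihilator_bot]
  have hfr : Module.finrank ℝ (Submodule.span ℝ S) = d := by
    rw [hspan, finrank_top, Subspace.dual_finrank_eq]; simp
  have hex := Submodule.exists_fun_fin_finrank_span_eq ℝ S
  rw [hfr] at hex
  obtain ⟨f, hf, hfs, -⟩ := hex
  choose T hT0 hT using hf
  refine ⟨T, ?_⟩
  have hP : ∀ i, c (T i) (PZ (fun i => c (T i))) = 0 :=
    Classical.epsilon_spec (p := fun y => ∀ i, c (T i) y = 0) ⟨v, hT0⟩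
  set y := PZ (fun i => c (T i))
  have hlin : ∀ l : Module.Dual ℝ (Fin d → ℝ), l (y - v) = 0 := by
    intro l
    have hl : l ∈ Submodule.span ℝ (Set.range f) := by rw [hfs, hspan]; trivial
    induction hl using Submodule.span_induction with
    | mem x hx =>
      obtain ⟨i, rfl⟩ := hx
      rw [← hT i]
      have h1 := aff_add (c (T i)) v (y - v)
      rw [add_sub_cancel, hP i, hT0 i] at h1
      linarith
    | zero => simp
    | add x y _ _ h1 h2 => simp only [LinearMap.add_apply, h1, h2, add_zero]
    | smul r x _ h => simp only [LinearMap.smul_apply, h, smul_zero]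
  have := hker (y - v) fun s _ => hlin _
  exact (sub_eq_zero.1 this).symm

lemma cell_convex {ι : Type*} (c : ι → ((Fin d → ℝ) →ᵃ[ℝ] ℝ)) (a : Fin d → ℝ) :
    Convex ℝ (cell c a) := by
  have : cell c a = ⋂ s, {y | (0 ≤ c s a → 0 ≤ c s y) ∧ (c s a ≤ 0 → c s y ≤ 0)} := by
    ext; simp [cell]
  rw [this]
  refine convex_iInter fun s => ?_
  have h1 : Convex ℝ {y | 0 ≤ c s y} := (convex_Ici (0:ℝ)).affine_preimage (c s)
  have h2 : Convex ℝ {y | c s y ≤ 0} := (convex_Iic (0:ℝ)).affine_preimage (c s)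
  have e : {y | (0 ≤ c s a → 0 ≤ c s y) ∧ (c s a ≤ 0 → c s y ≤ 0)} =
    {y | 0 ≤ c s a → 0 ≤ c s y} ∩ {y | c s a ≤ 0 → c s y ≤ 0} := rfl
  rw [e]
  refine Convex.inter ?_ ?_
  · by_cases h : 0 ≤ c s a
    · simpa [h] using h1
    · simpa [h] using convex_univ
  · by_cases h : c s a ≤ 0
    · simpa [h] using h2
    · simpa [h] using convex_univ

lemma cell_closed {ι : Type*} (c : ι → ((Fin d → ℝ) →ᵃ[ℝ] ℝ)) (a : Fin d → ℝ) :
    IsClosed (cell c a) := by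
  have : cell c a = ⋂ s, ({y | 0 ≤ c s a → 0 ≤ c s y} ∩ {y | c s a ≤ 0 → c s y ≤ 0}) := by
    ext; simp [cell]
  rw [this]
  refine isClosed_iInter fun s => ?_
  have hc : Continuous (c s) := (c s).continuous_of_finiteDimensional
  refine IsClosed.inter ?_ ?_
  · by_cases h : 0 ≤ c s a
    · simpa [h] using isClosed_le continuous_const hc
    · simp [h]
  · by_cases h : c s a ≤ 0
    · simpa [h] using isClosed_le hc continuous_const
    · simp [h]

lemma geo {ι : Type*} [Finite ι] (c : ι → ((Fin d → ℝ) →ᵃ[ℝ] ℝ)) (a : Fin d → ℝ)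
    (hb : Bornology.IsBounded (cell c a)) :
    ∃ τ : Fin (d+1) → Fin d → ι, (∀ m, PZ (fun i => c (τ m i)) ∈ cell c a) ∧
      a ∈ convexHull ℝ (Set.range fun m => PZ (fun i => c (τ m i))) ∧
      ∀ ψ : (Fin d → ℝ) →ᵃ[ℝ] ℝ, (∀ m, ψ (PZ (fun i => c (τ m i))) ≤ 0) → 0 ≤ ψ a →
        ∀ m, 0 ≤ ψ (PZ (fun i => c (τ m i))) := by
  have hcomp : IsCompact (cell c a) := Metric.isCompact_of_isClosed_isBounded (cell_closed c a) hb
  have hext : (Set.extremePoints ℝ (cell c a)).Finite := by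
    refine (Set.finite_range fun T : Fin d → ι => PZ (fun i => c (T i))).subset fun v hv => ?_
    obtain ⟨T, hT⟩ := extreme_eq_PZ c a v hv
    exact ⟨T, hT.symm⟩
  have ha : a ∈ cell c a := fun s => ⟨id, id⟩
  rw [← closure_convexHull_extremePoints hcomp (cell_convex c a),
    (hext.isCompact_convexHull ℝ).isClosed.closure_eq] at ha
  obtain ⟨κ, _, z, w, hz, haff, hw, hw1, hwa⟩ := eq_pos_convex_span_of_mem_convexHull ha
  have hcard : Fintype.card κ ≤ d + 1 := by
    refine haff.card_le_finrank_succ.trans ?_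
    have := Submodule.finrank_le (vectorSpan ℝ (Set.range z))
    simp at this; omega
  have hne : Nonempty κ := by
    by_contra h
    rw [not_nonempty_iff] at h
    simp at hw1
  obtain ⟨σ, hσ⟩ : ∃ σ : Fin (d+1) → κ, Function.Surjective σ := by
    have : Nonempty (κ ↪ Fin (d+1)) := Function.Embedding.nonempty_of_card_le (by simpa using hcard)
    obtain ⟨e⟩ := this
    exact ⟨Function.invFun e, Function.invFun_surjective e.injective⟩
  have hzT : ∀ k, ∃ T : Fin d → ι, z k = PZ (fun i => c (T i)) := fun k =>
    extreme_eq_PZ c a _ (hz ⟨k, rfl⟩)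
  choose T hT using hzT
  refine ⟨fun m => T (σ m), ?_, ?_, ?_⟩
  · intro m
    rw [← hT]
    exact (hz ⟨_, rfl⟩ : _ ∈ Set.extremePoints ℝ (cell c a)).1
  · rw [← hwa]
    refine (convex_convexHull ℝ _).sum_mem (fun k _ => (hw k).le) hw1 fun k _ => ?_
    obtain ⟨m, rfl⟩ := hσ k
    exact subset_convexHull _ _ ⟨m, (hT _).symm⟩
  · intro ψ hψ h0 m
    simp only [← hT] at hψ ⊢
    have hψ' : ∀ k, ψ (z k) ≤ 0 := fun k => by obtain ⟨m, rfl⟩ := hσ k; exact hψ m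
    have hsum : ψ a = ∑ k, w k * ψ (z k) := by
      have h1 := Finset.map_affineCombination Finset.univ z w hw1 ψ
      rw [Finset.affineCombination_eq_linear_combination _ _ _ hw1, hwa,
        Finset.affineCombination_eq_linear_combination _ _ _ hw1] at h1
      simpa using h1
    rw [hsum] at h0
    have h2 : ∀ k ∈ Finset.univ, w k * ψ (z k) ≤ 0 := fun k _ =>
      mul_nonpos_of_nonneg_of_nonpos (hw k).le (hψ' k)
    have h3 := (Finset.sum_eq_zero_iff_of_nonpos h2).1 (le_antisymm (Finset.sum_nonpos h2) h0)
      (σ m) (Finset.mem_univ _)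
    rcases mul_eq_zero.1 h3 with h | h
    · exact absurd h (hw _).ne'
    · exact h.ge

end Geo
end PachAux

namespace PachAux
open Finset

section Cut

lemma exists_r (D b M : ℕ) (x : ℝ) (hx0 : 0 < x) (hx1 : x < 1) :
    ∃ r : ℕ, 1 ≤ r ∧ ((M * r : ℕ) : ℝ) ^ D * x ^ (r - b) < 1 := by
  have h := tendsto_pow_const_mul_const_pow_of_abs_lt_one D (by rwa [abs_of_pos hx0] : |x| < 1)
  have hpos : 0 < x ^ b / ((M:ℝ) ^ D + 1) := by positivity
  obtain ⟨r, hr, hr1, hrb⟩ := ((h.eventually_lt_const hpos).and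
    ((Filter.eventually_ge_atTop 1).and (Filter.eventually_ge_atTop b))).exists
  refine ⟨r, hr1, ?_⟩
  have h1 : x ^ r = x ^ (r - b) * x ^ b := by rw [← pow_add]; congr 1; omega
  rw [h1, lt_div_iff₀ (by positivity)] at hr
  have hxb : 0 < x ^ b := by positivity
  push_cast
  rw [mul_pow]
  have h2 : (M:ℝ) ^ D * (r:ℝ) ^ D * x ^ (r - b) * x ^ b < 1 * x ^ b := by
    refine lt_of_le_of_lt ?_ (by simpa using hr)
    have : 0 ≤ (r:ℝ) ^ D * x ^ (r - b) * x ^ b := by positivity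
    nlinarith
  exact lt_of_mul_lt_mul_right h2 hxb.le

/-- indices of constraints -/
abbrev Idx (d r : ℕ) (ι : Type*) := (Fin r × ι) ⊕ (Fin d × Bool)

/-- all constraints: sampled functionals and box facets -/
noncomputable def constr {d r : ℕ} {ι α : Type*} (φ : α → ι → ((Fin d → ℝ) →ᵃ[ℝ] ℝ)) (R : ℝ)
    (f : Fin r → α) : Idx d r ι → ((Fin d → ℝ) →ᵃ[ℝ] ℝ) :=
  Sum.elim (fun q => φ (f q.1) q.2)
    (fun q => (LinearMap.proj q.1 : (Fin d → ℝ) →ₗ[ℝ] ℝ).toAffineMap +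
      AffineMap.const ℝ (Fin d → ℝ) (if q.2 then -R else R))

lemma cell_bounded {d r : ℕ} {ι α : Type*} (φ : α → ι → ((Fin d → ℝ) →ᵃ[ℝ] ℝ)) (R : ℝ)
    (f : Fin r → α) (a : Fin d → ℝ) (ha : ∀ j, |a j| ≤ R) :
    Bornology.IsBounded (cell (constr φ R f) a) := by
  refine (Metric.isBounded_Icc (fun _ : Fin d => -R) (fun _ => R)).subset fun y hy => ?_
  refine ⟨fun j => ?_, fun j => ?_⟩
  · have := (hy (Sum.inr (j, false))).1
    have h2 := abs_le.1 (ha j)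
    simp [constr] at this
    have := this (by linarith [h2.1])
    linarith
  · have := (hy (Sum.inr (j, true))).2
    have h2 := abs_le.1 (ha j)
    simp [constr] at this
    exact this h2.2

open Classical in
lemma cutL (d : ℕ) (ι : Type) [Fintype ι] (ε : ℝ) (hε : 0 < ε) : ∃ δ > (0:ℝ), ∀ {α : Type}
    (A : Finset (Fin d → ℝ)) (Ω : Finset α), A.Nonempty → Ω.Nonempty →
    ∀ φ : α → ι → ((Fin d → ℝ) →ᵃ[ℝ] ℝ),
    ε * (#A * #Ω) ≤ (#{q ∈ A ×ˢ Ω | ∀ i, 0 ≤ φ q.2 i q.1} : ℝ) →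
    ∃ A' ⊆ A, ∃ V : Fin (d+1) → (Fin d → ℝ), (∀ a ∈ A', a ∈ convexHull ℝ (Set.range V)) ∧
      δ * #A ≤ #A' ∧ δ * #Ω ≤ (#{ω ∈ Ω | ∀ i m, 0 ≤ φ ω i (V m)} : ℝ) := by
  set x : ℝ := 1 - min ε 1 / 2 with hx
  have hmin : 0 < min ε 1 := lt_min hε one_pos
  have hmin1 : min ε 1 ≤ 1 := min_le_right _ _
  obtain ⟨r, hr1, hr⟩ := exists_r (d * (d+1)) ((d+1) * d) (Fintype.card ι + d * 2) x
    (by linarith) (by linarith)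
  let Θ := Fin (d+1) → Fin d → Idx d r ι
  have hΘ : (Fintype.card Θ : ℝ) ≤
      (((Fintype.card ι + d * 2) * r : ℕ) : ℝ) ^ (d * (d+1)) := by
    have : Fintype.card Θ = ((r * Fintype.card ι + d * 2) ^ d) ^ (d+1) := by
      simp [Θ, Idx]
    rw [this]
    push_cast
    rw [← pow_mul]
    refine pow_le_pow_left₀ (by positivity) ?_ _
    have : (1:ℝ) ≤ r := by exact_mod_cast hr1
    have : (0:ℝ) ≤ d := by positivity
    nlinarith
  have hr' : (Fintype.card Θ : ℝ) * (1 - min ε 1 / 2) ^ (r - (d+1) * d) < 1 := by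
    refine lt_of_le_of_lt ?_ hr
    have : 0 ≤ x := by linarith
    gcongr
  refine ⟨min ε 1 / 2 / (Fintype.card Θ + 1), by positivity, ?_⟩
  intro α A Ω hA hΩ φ hcount
  obtain ⟨R, hR⟩ : ∃ R : ℝ, ∀ a ∈ A, ∀ j, |a j| ≤ R := by
    refine ⟨∑ a ∈ A, ‖a‖, fun a ha j => ?_⟩
    refine (norm_le_pi_norm a j).trans ?_
    exact Finset.single_le_sum (f := fun a : Fin d → ℝ => ‖a‖) (fun _ _ => norm_nonneg _) ha
  let VV : Θ → (Fin r → α) → Fin (d+1) → (Fin d → ℝ) := fun τ f m =>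
    PZ (fun i => constr φ R f (τ m i))
  let jj : Idx d r ι → Finset (Fin r) := fun s => Sum.elim (fun q => {q.1}) (fun _ => ∅) s
  let J : Θ → Finset (Fin r) := fun τ =>
    (Finset.univ : Finset (Fin (d+1) × Fin d)).biUnion fun q => jj (τ q.1 q.2)
  let C : Θ → (Fin r → α) → α → Prop := fun τ f ω =>
    ∃ i m m', φ ω i (VV τ f m) < 0 ∧ 0 < φ ω i (VV τ f m')
  obtain ⟨f, hf⟩ := net_lemma Ω hΩ r ((d+1) * d) J (by
      intro τ
      refine (Finset.card_biUnion_le_card_mul _ _ 1 ?_).trans (by simp)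
      rintro ⟨m, i⟩ -
      simp only [jj]
      rcases τ m i with q | q <;> simp) C (by
      intro τ f f' hff ω
      have : VV τ f = VV τ f' := by
        funext m
        simp only [VV]
        congr 1
        funext i
        have hh : ∀ t ∈ jj (τ m i), f t = f' t := fun t ht => hff t
          (Finset.mem_biUnion.2 ⟨(m, i), Finset.mem_univ _, ht⟩)
        revert hh
        rcases τ m i with q | q
        · intro hh
          simp only [jj, Sum.elim_inl, Finset.mem_singleton, forall_eq] at hh
          simp [constr, hh]
        · intro _; simp [constr]
      simp only [C, this]) (min ε 1 / 2) (by positivity) (by linarith) hr'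
  have hgeo : ∀ a ∈ A, ∃ τ : Θ, (∀ m, VV τ f m ∈ cell (constr φ R f) a) ∧
      a ∈ convexHull ℝ (Set.range (VV τ f)) ∧
      ∀ ψ : (Fin d → ℝ) →ᵃ[ℝ] ℝ, (∀ m, ψ (VV τ f m) ≤ 0) → 0 ≤ ψ a →
        ∀ m, 0 ≤ ψ (VV τ f m) := fun a ha =>
    geo (constr φ R f) a (cell_bounded φ R f a (hR a ha))
  have hΘne : Nonempty Θ := by
    obtain ⟨a, ha⟩ := hA
    exact ⟨(hgeo a ha).choose⟩
  choose! τ hτ1 hτ2 hτ3 using hgeo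
  let G : Θ → ℝ := fun t => #{ω ∈ Ω | ∀ i m, 0 ≤ φ ω i (VV t f m)}
  have hApos : (0:ℝ) < #A := by exact_mod_cast Finset.card_pos.2 hA
  have hΩpos : (0:ℝ) < #Ω := by exact_mod_cast Finset.card_pos.2 hΩ
  have hper : ∀ a ∈ A, (#{ω ∈ Ω | ∀ i, 0 ≤ φ ω i a} : ℝ) ≤ G (τ a) + min ε 1 / 2 * #Ω := by
    intro a ha
    have hC : (#{ω ∈ Ω | C (τ a) f ω} : ℝ) ≤ min ε 1 / 2 * #Ω := by
      have hnot : ¬ ∃ t ∉ J (τ a), C (τ a) f (f t) := ?_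
      · have := (hf (τ a)).resolve_left hnot
        convert this
      rintro ⟨t, -, i, m, m', h1, h2⟩
      have c1 := hτ1 a ha m (Sum.inl (t, i))
      have c2 := hτ1 a ha m' (Sum.inl (t, i))
      simp only [constr, Sum.elim_inl] at c1 c2
      rcases le_total 0 (φ (f t) i a) with h | h
      · linarith [c1.1 h]
      · linarith [c2.2 h]
    have hsub : {ω ∈ Ω | ∀ i, 0 ≤ φ ω i a} ⊆
        {ω ∈ Ω | ∀ i m, 0 ≤ φ ω i (VV (τ a) f m)} ∪ {ω ∈ Ω | C (τ a) f ω} := by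
      intro ω hω
      obtain ⟨hω, h⟩ := Finset.mem_filter.1 hω
      rw [Finset.mem_union, Finset.mem_filter, Finset.mem_filter]
      by_cases hc : C (τ a) f ω
      · exact Or.inr ⟨hω, hc⟩
      · refine Or.inl ⟨hω, fun i m => ?_⟩
        by_contra hneg
        push Not at hneg
        have hall : ∀ m', φ ω i (VV (τ a) f m') ≤ 0 := by
          intro m'
          by_contra h'
          push Not at h'
          exact hc ⟨i, m, m', hneg, h'⟩
        exact absurd (hτ3 a ha (φ ω i) hall (h i) m) (not_le.2 hneg)
    have h1 := (Finset.card_le_card hsub).trans (Finset.card_union_le _ _)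
    have h2 : (#{ω ∈ Ω | ∀ i, 0 ≤ φ ω i a} : ℝ) ≤ G (τ a) + #{ω ∈ Ω | C (τ a) f ω} := by
      simp only [G]; exact_mod_cast h1
    linarith
  have hsum : (#{q ∈ A ×ˢ Ω | ∀ i, 0 ≤ φ q.2 i q.1} : ℝ) = ∑ a ∈ A, (#{ω ∈ Ω | ∀ i, 0 ≤ φ ω i a} : ℝ) := by
    simp only [Finset.card_filter]
    push_cast
    rw [Finset.sum_product]
  have h3 : min ε 1 / 2 * (#A * #Ω) ≤ ∑ a ∈ A, G (τ a) := by
    have h4 := Finset.sum_le_sum hper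
    rw [← hsum, Finset.sum_add_distrib, Finset.sum_const, nsmul_eq_mul] at h4
    have h5 : min ε 1 * (#A * #Ω) ≤ ε * (#A * #Ω) := by
      gcongr; exact min_le_left _ _
    nlinarith
  have h4 : ∑ a ∈ A, G (τ a) = ∑ t : Θ, (#{a ∈ A | τ a = t} : ℝ) * G t := by
    rw [← Finset.sum_fiberwise A τ (fun a => G (τ a))]
    refine Finset.sum_congr rfl fun t _ => ?_
    rw [Finset.sum_congr rfl (g := fun _ => G t) (fun a ha => by rw [(Finset.mem_filter.1 ha).2]),
      Finset.sum_const, nsmul_eq_mul]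
  have h5 : ∃ t : Θ, min ε 1 / 2 / (Fintype.card Θ + 1) * (#A * #Ω) ≤ (#{a ∈ A | τ a = t} : ℝ) * G t := by
    by_contra hcon
    push Not at hcon
    have h6 := Finset.sum_lt_sum_of_nonempty (Finset.univ_nonempty (α := Θ)) (fun t _ => hcon t)
    rw [Finset.sum_const, Finset.card_univ, nsmul_eq_mul, ← h4] at h6
    have h7 : (Fintype.card Θ : ℝ) * (min ε 1 / 2 / (Fintype.card Θ + 1) * (#A * #Ω)) ≤
        min ε 1 / 2 * (#A * #Ω) := by
      have : (Fintype.card Θ : ℝ) / (Fintype.card Θ + 1) ≤ 1 := by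
        rw [div_le_one (by positivity)]; linarith
      calc (Fintype.card Θ : ℝ) * (min ε 1 / 2 / (Fintype.card Θ + 1) * (#A * #Ω))
          = ((Fintype.card Θ : ℝ) / (Fintype.card Θ + 1)) * (min ε 1 / 2 * (#A * #Ω)) := by ring
        _ ≤ 1 * (min ε 1 / 2 * (#A * #Ω)) := by gcongr
        _ = _ := one_mul _
    linarith
  obtain ⟨t, ht⟩ := h5
  have hG : G t ≤ #Ω := by simp only [G]; exact_mod_cast Finset.card_filter_le _ _
  have hG0 : 0 ≤ G t := by simp only [G]; positivity
  have hAt : (#{a ∈ A | τ a = t} : ℝ) ≤ #A := by exact_mod_cast Finset.card_filter_le _ _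
  refine ⟨{a ∈ A | τ a = t}, Finset.filter_subset _ _, VV t f, ?_, ?_, ?_⟩
  · intro a ha
    obtain ⟨ha', rfl⟩ := Finset.mem_filter.1 ha
    exact hτ2 a ha'
  · have : min ε 1 / 2 / (Fintype.card Θ + 1) * #A * #Ω ≤ (#{a ∈ A | τ a = t} : ℝ) * #Ω := by
      rw [mul_assoc]
      exact ht.trans (by gcongr)
    exact le_of_mul_le_mul_right this hΩpos
  · have : min ε 1 / 2 / (Fintype.card Θ + 1) * #Ω * #A ≤ G t * #A := by
      rw [mul_assoc, mul_comm (#Ω : ℝ), mul_comm (G t)]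
      exact ht.trans (by gcongr)
    exact le_of_mul_le_mul_right this hApos

/-- multi-affine functions -/
def MA {d n : ℕ} (F : (Fin n → (Fin d → ℝ)) → ℝ) : Prop :=
  ∀ x j, ∃ φ : (Fin d → ℝ) →ᵃ[ℝ] ℝ, ∀ y, F (Function.update x j y) = φ y

open Classical in
theorem boxM (d : ℕ) : ∀ (n : ℕ) (ι : Type) [Fintype ι] (ε : ℝ), 0 < ε → ∃ δ > (0:ℝ),
    ∀ (X : Fin n → Finset (Fin d → ℝ)), (∀ j, (X j).Nonempty) →
    ∀ F : ι → (Fin n → (Fin d → ℝ)) → ℝ, (∀ i, MA (F i)) →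
    ε * ∏ j, (#(X j) : ℝ) ≤ (#{x ∈ Fintype.piFinset X | ∀ i, 0 ≤ F i x} : ℝ) →
    ∃ Z : Fin n → Finset (Fin d → ℝ), (∀ j, Z j ⊆ X j) ∧ (∀ j, δ * #(X j) ≤ (#(Z j) : ℝ)) ∧
      ∀ x, (∀ j, x j ∈ Z j) → ∀ i, 0 ≤ F i x := by
  intro n
  induction n with
  | zero =>
    intro ι _ ε hε
    refine ⟨1, one_pos, fun X _ F _ h => ⟨X, fun _ => subset_rfl, fun j => j.elim0, ?_⟩⟩
    have hpos : (0:ℝ) < (#{x ∈ Fintype.piFinset X | ∀ i, 0 ≤ F i x} : ℝ) := by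
      refine lt_of_lt_of_le ?_ h
      simpa using hε
    have hne : ({x ∈ Fintype.piFinset X | ∀ i, 0 ≤ F i x}).Nonempty :=
      Finset.card_pos.1 (by exact_mod_cast hpos)
    obtain ⟨x0, hx0⟩ := hne
    intro x _ i
    rw [Subsingleton.elim x x0]
    exact (Finset.mem_filter.1 hx0).2 i
  | succ n ih =>
    intro ι _ ε hε
    obtain ⟨δ1, hδ1, H1⟩ := cutL d ι ε hε
    obtain ⟨δ2, hδ2, H2⟩ := ih (ι × Fin (d+1)) δ1 hδ1
    refine ⟨min δ1 δ2, lt_min hδ1 hδ2, fun X hX F hF h => ?_⟩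
    let Ω : Finset (Fin n → (Fin d → ℝ)) := Fintype.piFinset fun j => X j.succ
    have hΩcard : (#Ω : ℝ) = ∏ j : Fin n, (#(X j.succ) : ℝ) := by
      simp [Ω, Fintype.card_piFinset]
    have hΩ : Ω.Nonempty := by
      rw [Fintype.piFinset_nonempty]; exact fun j => hX j.succ
    have hcons : ∀ (y z : Fin d → ℝ) (ω : Fin n → (Fin d → ℝ)), Function.update (Fin.cons z ω : Fin (n+1) → (Fin d → ℝ)) 0 y =
      Fin.cons y ω := fun y z ω => Fin.update_cons_zero (α := fun _ => Fin d → ℝ) z ω y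
    have hφ : ∀ ω : Fin n → (Fin d → ℝ), ∀ i, ∃ φ : (Fin d → ℝ) →ᵃ[ℝ] ℝ, ∀ y,
        F i (Fin.cons y ω : Fin (n+1) → (Fin d → ℝ)) = φ y := by
      intro ω i
      obtain ⟨φ, hφ⟩ := hF i (Fin.cons 0 ω : Fin (n+1) → (Fin d → ℝ)) 0
      exact ⟨φ, fun y => by rw [← hφ, hcons]⟩
    choose φ hφ using hφ
    obtain ⟨A', hA', V, hV, hcA, hcΩ⟩ := H1 (X 0) Ω (hX 0) hΩ φ (by
      rw [hΩcard, ← Fin.prod_univ_succ (fun j => (#(X j) : ℝ))]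
      refine h.trans ?_
      rw [Nat.cast_le]
      refine Finset.card_le_card_of_injOn (fun x => (x 0, Fin.tail x)) ?_ ?_
      · intro x hx
        obtain ⟨hx1, hx2⟩ := Finset.mem_filter.1 (Finset.mem_coe.1 hx)
        rw [Fintype.mem_piFinset] at hx1
        refine Finset.mem_coe.2 (Finset.mem_filter.2 ⟨Finset.mem_product.2 ⟨hx1 0, ?_⟩, ?_⟩)
        · exact Fintype.mem_piFinset.2 fun j => hx1 j.succ
        · intro i
          rw [← hφ]
          simpa [Fin.cons_self_tail] using hx2 i
      · intro x _ y _ hxy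
        simp only [Prod.mk.injEq] at hxy
        rw [← Fin.cons_self_tail x, ← Fin.cons_self_tail y, hxy.1, hxy.2])
    obtain ⟨Z, hZ1, hZ2, hZ3⟩ := H2 (fun j => X j.succ) (fun j => hX j.succ)
      (fun q ω => F q.1 (Fin.cons (V q.2) ω : Fin (n+1) → (Fin d → ℝ))) (by
        intro q x j
        obtain ⟨ψ, hψ⟩ := hF q.1 (Fin.cons (V q.2) x : Fin (n+1) → (Fin d → ℝ)) j.succ
        refine ⟨ψ, fun y => ?_⟩
        rw [← hψ]
        dsimp only
        rw [Fin.cons_update]) (by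
        rw [← hΩcard]
        refine hcΩ.trans ?_
        rw [Nat.cast_le]
        refine Finset.card_le_card fun ω hω => ?_
        obtain ⟨h1, h2⟩ := Finset.mem_filter.1 hω
        refine Finset.mem_filter.2 ⟨h1, fun q => ?_⟩
        rw [hφ]; exact h2 q.1 q.2)
    refine ⟨Fin.cons A' Z, ?_, ?_, ?_⟩
    · intro j
      refine Fin.cases ?_ (fun j => ?_) j
      · simpa using hA'
      · simpa using hZ1 j
    · intro j
      refine Fin.cases ?_ (fun j => ?_) j
      · simp only [Fin.cons_zero]
        exact le_trans (by gcongr; exact min_le_left _ _) hcA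
      · simp only [Fin.cons_succ]
        exact le_trans (by gcongr; exact min_le_right _ _) (hZ2 j)
    · intro x hx i
      have h0 : x 0 ∈ A' := by simpa using hx 0
      have h1 : ∀ j, Fin.tail x j ∈ Z j := fun j => by simpa [Fin.tail] using hx j.succ
      have h2 : ∀ m, 0 ≤ φ (Fin.tail x) i (V m) := fun m => by
        rw [← hφ]; exact hZ3 (Fin.tail x) h1 (i, m)
      have h3 : x 0 ∈ {y | 0 ≤ φ (Fin.tail x) i y} := by
        refine convexHull_min ?_ ((convex_Ici (0:ℝ)).affine_preimage (φ (Fin.tail x) i)) (hV _ h0)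
        rintro _ ⟨m, rfl⟩
        exact h2 m
      have h4 : 0 ≤ φ (Fin.tail x) i (x 0) := h3
      rwa [← hφ, Fin.cons_self_tail] at h4

end Cut
end PachAux

namespace PachAux
open Finset

section Final

/-- homogenisation -/
def lift1 {d : ℕ} (y : Fin d → ℝ) : Fin (d+1) → ℝ := Fin.cons 1 y

/-- matrix with columns the lifted points -/
def matA {d : ℕ} (x : Fin (d+1) → (Fin d → ℝ)) : Matrix (Fin (d+1)) (Fin (d+1)) ℝ :=
  Matrix.of fun i j => lift1 (x j) i

lemma matA_mulVec_zero {d : ℕ} (x : Fin (d+1) → (Fin d → ℝ)) (w : Fin (d+1) → ℝ) :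
    (matA x).mulVec w 0 = ∑ j, w j := by
  simp [matA, Matrix.mulVec, dotProduct, lift1]

lemma matA_mulVec_succ {d : ℕ} (x : Fin (d+1) → (Fin d → ℝ)) (w : Fin (d+1) → ℝ) (i : Fin d) :
    (matA x).mulVec w i.succ = (∑ j, w j • x j) i := by
  simp [matA, Matrix.mulVec, dotProduct, lift1, mul_comm]

lemma matA_det_ne {d : ℕ} (x : Fin (d+1) → (Fin d → ℝ)) (hx : AffineIndependent ℝ x) :
    (matA x).det ≠ 0 := by
  intro h
  obtain ⟨w, hw, hw0⟩ := Matrix.exists_mulVec_eq_zero_iff.2 h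
  apply hw
  funext j
  refine affineIndependent_iff.1 hx Finset.univ w ?_ ?_ j (Finset.mem_univ _)
  · rw [← matA_mulVec_zero x, hw0]; rfl
  · funext i; rw [← matA_mulVec_succ x, hw0]; rfl

/-- Cramer determinants -/
noncomputable def DD {d : ℕ} (q : Fin d → ℝ) (j : Fin (d+1)) (x : Fin (d+1) → (Fin d → ℝ)) : ℝ :=
  (matA x).cramer (lift1 q) j

lemma mem_of_DD {d : ℕ} (q : Fin d → ℝ) (x : Fin (d+1) → (Fin d → ℝ))
    (hx : AffineIndependent ℝ x) (σ : ℝ) (h : ∀ j, 0 ≤ σ * DD q j x) (hσ : σ ≠ 0) :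
    q ∈ convexHull ℝ (Set.range x) := by
  have hdet := matA_det_ne x hx
  have hm := Matrix.mulVec_cramer (matA x) (lift1 q)
  have h0 : ∑ j, DD q j x = (matA x).det := by
    have := congrFun hm 0
    rw [matA_mulVec_zero] at this
    simpa [lift1, DD] using this
  have h1 : ∑ j, DD q j x • x j = (matA x).det • q := by
    funext i
    have := congrFun hm i.succ
    rw [matA_mulVec_succ] at this
    simpa [lift1, DD] using this
  have hs : 0 < σ * (matA x).det := by
    refine lt_of_le_of_ne ?_ (mul_ne_zero hσ hdet).symm
    rw [← h0, Finset.mul_sum]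
    exact Finset.sum_nonneg fun j _ => h j
  refine mem_convexHull_of_exists_fintype (fun j => (matA x).det⁻¹ * DD q j x) x ?_ ?_
    (fun j => ⟨j, rfl⟩) ?_
  · intro j
    have : (matA x).det⁻¹ * DD q j x = (σ * DD q j x) / (σ * (matA x).det) := by
      field_simp
    rw [this]
    exact div_nonneg (h j) hs.le
  · rw [← Finset.mul_sum, h0, inv_mul_cancel₀ hdet]
  · simp only [mul_smul]
    rw [← Finset.smul_sum, h1, smul_smul, inv_mul_cancel₀ hdet, one_smul]

lemma DD_of_mem {d : ℕ} (q : Fin d → ℝ) (x : Fin (d+1) → (Fin d → ℝ))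
    (h : q ∈ convexHull ℝ (Set.range x)) :
    (∀ j, 0 ≤ 1 * DD q j x) ∨ (∀ j, 0 ≤ (-1) * DD q j x) := by
  classical
  obtain ⟨w, hw0, hw1, hwq⟩ : ∃ w : Fin (d+1) → ℝ, (∀ j, 0 ≤ w j) ∧ ∑ j, w j = 1 ∧
      ∑ j, w j • x j = q := by
    rw [convexHull_range_eq_exists_affineCombination] at h
    obtain ⟨s, w, h0, h1, h2⟩ := h
    rw [Finset.affineCombination_eq_linear_combination _ _ _ h1] at h2
    refine ⟨fun j => if j ∈ s then w j else 0, fun j => ?_, ?_, ?_⟩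
    · dsimp only; split_ifs with hj
      · exact h0 j hj
      · exact le_rfl
    · simpa using h1
    · simpa [ite_smul] using h2
  have hA : (matA x).mulVec w = lift1 q := by
    funext i
    refine Fin.cases ?_ (fun i => ?_) i
    · rw [matA_mulVec_zero, hw1]; rfl
    · rw [matA_mulVec_succ, hwq]; rfl
  have hD : ∀ j, DD q j x = (matA x).det * w j := by
    intro j
    rw [DD, ← hA, Matrix.cramer_eq_adjugate_mulVec, Matrix.mulVec_mulVec, Matrix.adjugate_mul,
      Matrix.smul_mulVec, Matrix.one_mulVec]
    rfl
  rcases le_total 0 (matA x).det with hd | hd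
  · left; intro j; rw [hD, one_mul]; exact mul_nonneg hd (hw0 j)
  · right; intro j; rw [hD]; nlinarith [hw0 j]

lemma DD_MA {d : ℕ} (q : Fin d → ℝ) (j : Fin (d+1)) (σ : ℝ) :
    MA (fun x => σ * DD q j x) := by
  intro x k
  have hup : ∀ y, matA (Function.update x k y) = (matA x).updateCol k (lift1 y) := by
    intro y
    ext i l
    rw [Matrix.updateCol_apply]
    by_cases h : l = k
    · subst h; simp [matA]
    · simp [matA, h]
  by_cases hjk : k = j
  · subst hjk
    refine ⟨AffineMap.const ℝ _ (σ * ((matA x).updateCol k (lift1 q)).det), fun y => ?_⟩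
    simp only [DD, Matrix.cramer_apply, hup, Matrix.updateCol_idem, AffineMap.const_apply]
  · let M := (matA x).updateCol j (lift1 q)
    let l : (Fin (d+1) → ℝ) →ₗ[ℝ] ℝ := σ • ((LinearMap.proj k) ∘ₗ M.cramer)
    let Lz : (Fin d → ℝ) →ₗ[ℝ] (Fin (d+1) → ℝ) :=
      LinearMap.pi (Fin.cons 0 (fun i => LinearMap.proj i) : Fin (d+1) → ((Fin d → ℝ) →ₗ[ℝ] ℝ))
    refine ⟨(l ∘ₗ Lz).toAffineMap + AffineMap.const ℝ _ (l (lift1 0)), fun y => ?_⟩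
    have h1 : lift1 y = Lz y + lift1 0 := by
      funext i
      refine Fin.cases ?_ (fun i => ?_) i <;> simp [lift1, Lz]
    simp only [DD, Matrix.cramer_apply, hup]
    rw [Matrix.updateCol_comm _ hjk, ← Matrix.cramer_apply]
    change l (lift1 y) = _
    rw [h1, map_add]
    rfl

open Classical in
theorem coreW (d : ℕ) : ∃ δ > (0:ℝ), ∀ X : Fin (d+1) → Finset (Fin d → ℝ),
    (∀ j, (X j).Nonempty) →
    (∀ x : Fin (d+1) → (Fin d → ℝ), (∀ j, x j ∈ X j) → AffineIndependent ℝ x) →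
    ∃ q, ∃ Z : Fin (d+1) → Finset (Fin d → ℝ), (∀ j, Z j ⊆ X j) ∧
      (∀ j, δ * #(X j) ≤ (#(Z j) : ℝ)) ∧
      ∀ x : Fin (d+1) → (Fin d → ℝ), (∀ j, x j ∈ Z j) → q ∈ convexHull ℝ (Set.range x) := by
  obtain ⟨ε, hε, hsel⟩ := selection d
  obtain ⟨δ, hδ, hbox⟩ := boxM d (d+1) (Fin (d+1)) (ε/2) (by positivity)
  refine ⟨δ, hδ, fun X hX haff => ?_⟩
  obtain ⟨q, hq⟩ := hsel X hX
  have hsplit : ∃ σ : ℝ, σ ≠ 0 ∧ ε / 2 * ∏ j, (#(X j) : ℝ) ≤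
      (#{x ∈ Fintype.piFinset X | ∀ j, 0 ≤ σ * DD q j x} : ℝ) := by
    by_contra hcon
    push Not at hcon
    have h1 := hcon 1 one_ne_zero
    have h2 := hcon (-1) (by norm_num)
    have h3 : #{x ∈ Fintype.piFinset X | q ∈ convexHull ℝ (Set.range x)} ≤
        #{x ∈ Fintype.piFinset X | ∀ j, 0 ≤ 1 * DD q j x} +
        #{x ∈ Fintype.piFinset X | ∀ j, 0 ≤ (-1) * DD q j x} := by
      refine (Finset.card_le_card ?_).trans (Finset.card_union_le _ _)
      intro x hx
      obtain ⟨hx1, hx2⟩ := Finset.mem_filter.1 hx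
      rw [Finset.mem_union, Finset.mem_filter, Finset.mem_filter]
      rcases DD_of_mem q x hx2 with h | h
      · exact Or.inl ⟨hx1, h⟩
      · exact Or.inr ⟨hx1, h⟩
    have h4 : (#{x ∈ Fintype.piFinset X | q ∈ convexHull ℝ (Set.range x)} : ℝ) ≤
        #{x ∈ Fintype.piFinset X | ∀ j, 0 ≤ 1 * DD q j x} +
        #{x ∈ Fintype.piFinset X | ∀ j, 0 ≤ (-1) * DD q j x} := by exact_mod_cast h3
    linarith
  obtain ⟨σ, hσ, hc⟩ := hsplit
  obtain ⟨Z, hZ1, hZ2, hZ3⟩ := hbox X hX (fun j x => σ * DD q j x) (fun j => DD_MA q j σ)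
    (by convert hc)
  exact ⟨q, Z, hZ1, hZ2, fun x hx => mem_of_DD q x (haff x fun j => hZ1 j (hx j)) σ (hZ3 x hx) hσ⟩

open Classical in
theorem coreE (d : ℕ) : ∃ δ > (0:ℝ), ∀ X : Fin (d+1) → Finset (EuclideanSpace ℝ (Fin d)),
    (∀ j, (X j).Nonempty) →
    (∀ x : Fin (d+1) → EuclideanSpace ℝ (Fin d), (∀ j, x j ∈ X j) → AffineIndependent ℝ x) →
    ∃ q, ∃ Z : Fin (d+1) → Finset (EuclideanSpace ℝ (Fin d)), (∀ j, Z j ⊆ X j) ∧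
      (∀ j, δ * #(X j) ≤ (#(Z j) : ℝ)) ∧
      ∀ x : Fin (d+1) → EuclideanSpace ℝ (Fin d), (∀ j, x j ∈ Z j) →
        q ∈ convexHull ℝ (Set.range x) := by
  obtain ⟨δ, hδ, H⟩ := coreW d
  refine ⟨δ, hδ, fun X hX haff => ?_⟩
  let e : EuclideanSpace ℝ (Fin d) ≃ₗ[ℝ] (Fin d → ℝ) := WithLp.linearEquiv 2 ℝ (Fin d → ℝ)
  obtain ⟨q, Z, h1, h2, h3⟩ := H (fun j => (X j).image e) (fun j => (hX j).image e) (by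
    intro x hx
    have h := haff (fun j => e.symm (x j)) (fun j => by
      obtain ⟨y, hy, hyx⟩ := Finset.mem_image.1 (hx j)
      rw [← hyx]; simpa using hy)
    have h' := h.map' e.toLinearMap.toAffineMap e.injective
    have heq : (⇑(e.toLinearMap.toAffineMap) ∘ fun j => e.symm (x j)) = x := by
      funext j; simp
    rw [heq] at h'
    exact h')
  refine ⟨e.symm q, fun j => (Z j).image e.symm, ?_, ?_, ?_⟩
  · intro j y hy
    obtain ⟨z, hz, rfl⟩ := Finset.mem_image.1 hy
    obtain ⟨y', hy', rfl⟩ := Finset.mem_image.1 (h1 j hz)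
    simpa using hy'
  · intro j
    have := h2 j
    rw [Finset.card_image_of_injective _ e.injective] at this
    rw [Finset.card_image_of_injective _ e.symm.injective]
    exact this
  · intro x hx
    have := h3 (fun j => e (x j)) (fun j => by
      obtain ⟨z, hz, hzx⟩ := Finset.mem_image.1 (hx j)
      rw [← hzx]; simpa using hz)
    have h4 := Set.mem_image_of_mem e.symm.toLinearMap this
    rw [LinearMap.image_convexHull, ← Set.range_comp] at h4
    have heq : (⇑e.symm.toLinearMap ∘ fun j => e (x j)) = x := by
      funext j; simp
    rw [heq] at h4
    exact h4

lemma disjointify {α : Type*} [DecidableEq α] {n : ℕ} (hn : 0 < n) (X : Fin n → Finset α)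
    (hX : ∀ i, n ≤ #(X i)) :
    ∃ X' : Fin n → Finset α, (∀ i, X' i ⊆ X i) ∧ (∀ i, #(X i) ≤ 2 * n * #(X' i)) ∧
      ∀ x : Fin n → α, (∀ i, x i ∈ X' i) → Function.Injective x := by
  let k : Fin n → ℕ := fun i => #(X i) / n
  let I := Σ i : Fin n, Fin (k i)
  obtain ⟨f, hf, hfX⟩ := (Finset.all_card_le_biUnion_card_iff_exists_injective
    (fun q : I => X q.1)).1 (by
    intro s
    rcases s.eq_empty_or_nonempty with rfl | hs
    · simp
    · obtain ⟨q0, hq0, hmax⟩ := Finset.exists_max_image s (fun q => #(X q.1)) hs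
      have h1 : #s ≤ n * (#(X q0.1) / n) := by
        have h2 : s ⊆ (s.image Sigma.fst).sigma fun i => (Finset.univ : Finset (Fin (k i))) := by
          intro q hq
          exact Finset.mem_sigma.2 ⟨Finset.mem_image_of_mem _ hq, Finset.mem_univ _⟩
        refine (Finset.card_le_card h2).trans ?_
        rw [Finset.card_sigma]
        simp only [Finset.card_univ, Fintype.card_fin]
        refine (Finset.sum_le_card_nsmul _ _ (#(X q0.1) / n) ?_).trans ?_
        · intro i hi
          obtain ⟨q, hq, rfl⟩ := Finset.mem_image.1 hi
          exact Nat.div_le_div_right (hmax q hq)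
        · rw [smul_eq_mul]
          refine Nat.mul_le_mul_right _ ?_
          simpa using Finset.card_le_univ (s.image Sigma.fst)
      refine (h1.trans (Nat.mul_div_le _ _)).trans (Finset.card_le_card ?_)
      exact Finset.subset_biUnion_of_mem (fun q : I => X q.1) hq0)
  refine ⟨fun i => Finset.univ.image fun t : Fin (k i) => f ⟨i, t⟩, ?_, ?_, ?_⟩
  · intro i y hy
    obtain ⟨t, -, rfl⟩ := Finset.mem_image.1 hy
    exact hfX ⟨i, t⟩
  · intro i
    rw [Finset.card_image_of_injective _ (fun t t' h => by
      exact eq_of_heq (Sigma.mk.inj (hf h)).2)]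
    rw [Finset.card_univ, Fintype.card_fin]
    have h1 : 1 ≤ k i := (Nat.one_le_div_iff hn).2 (hX i)
    have h2 : #(X i) < n * (k i + 1) := by
      have := Nat.lt_mul_div_succ (#(X i)) hn
      simpa [k] using this
    nlinarith
  · intro x hx i j hij
    obtain ⟨t, -, ht⟩ := Finset.mem_image.1 (hx i)
    obtain ⟨t', -, ht'⟩ := Finset.mem_image.1 (hx j)
    have : f ⟨i, t⟩ = f ⟨j, t'⟩ := by rw [ht, ht', hij]
    exact congrArg Sigma.fst (hf this)

end Final
end PachAux

/-- **Pach's theorem** (fractional/colorful centerpoint theorem). -/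
theorem pach_selection (d : ℕ) (hd : 1 ≤ d) :
    ∃ c : ℝ, 0 < c ∧
      ∀ X : Fin (d + 1) → Finset (EuclideanSpace ℝ (Fin d)),
        InGeneralPosition (⋃ i, ((X i : Set (EuclideanSpace ℝ (Fin d))))) →
        ∃ q : EuclideanSpace ℝ (Fin d), ∃ Y : Fin (d + 1) → Finset (EuclideanSpace ℝ (Fin d)),
          (∀ i, Y i ⊆ X i) ∧
          (∀ i, c * ((X i).card : ℝ) ≤ ((Y i).card : ℝ)) ∧
          (∀ x : Fin (d + 1) → EuclideanSpace ℝ (Fin d),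
            (∀ i, x i ∈ Y i) → q ∈ convexHull ℝ (Set.range x)) := by
  classical
  obtain ⟨δ, hδ, H⟩ := PachAux.coreE d
  have hn : (0:ℝ) < 2 * ((d + 1 : ℕ) : ℝ) := by positivity
  have hn1 : (1:ℝ) ≤ ((d + 1 : ℕ) : ℝ) := by exact_mod_cast Nat.le_add_left 1 d
  refine ⟨min 1 δ / (2 * ((d + 1 : ℕ) : ℝ)), by positivity, fun X hgp => ?_⟩
  set c := min 1 δ / (2 * ((d + 1 : ℕ) : ℝ)) with hc
  have hmin : 0 < min 1 δ := lt_min one_pos hδ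
  have hcn : c * ((d + 1 : ℕ) : ℝ) ≤ 1 := by
    rw [hc, div_mul_eq_mul_div, div_le_one hn]
    nlinarith [min_le_left 1 δ]
  have hc0 : 0 < c := by positivity
  have hc1 : c ≤ 1 := by nlinarith
  by_cases hsmall : ∀ i, d + 1 ≤ (X i).card
  · obtain ⟨X', h1, h2, h3⟩ := PachAux.disjointify (Nat.succ_pos d) X hsmall
    have hne : ∀ i, (X' i).Nonempty := by
      intro i
      by_contra h
      rw [Finset.not_nonempty_iff_eq_empty] at h
      have a := h2 i
      have b := hsmall i
      rw [h, Finset.card_empty, Nat.mul_zero] at a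
      omega
    obtain ⟨q, Z, hZ1, hZ2, hZ3⟩ := H X' hne (fun x hx => hgp x
      (fun i => Set.mem_iUnion.2 ⟨i, h1 i (hx i)⟩) (h3 x hx))
    refine ⟨q, Z, fun i => (hZ1 i).trans (h1 i), fun i => ?_, hZ3⟩
    refine le_trans ?_ (hZ2 i)
    have h4 : ((X i).card : ℝ) ≤ 2 * ((d + 1 : ℕ) : ℝ) * ((X' i).card : ℝ) := by
      exact_mod_cast h2 i
    calc c * ((X i).card : ℝ) ≤ c * (2 * ((d + 1 : ℕ) : ℝ) * ((X' i).card : ℝ)) := by gcongr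
      _ = min 1 δ * ((X' i).card : ℝ) := by rw [hc]; field_simp
      _ ≤ δ * ((X' i).card : ℝ) := by gcongr; exact min_le_right _ _
  · push Not at hsmall
    obtain ⟨i0, hi0⟩ := hsmall
    have htriv : ∀ i, c * ((X i).card : ℝ) ≤ ((X i).card : ℝ) := fun i => by
      have : (0:ℝ) ≤ (X i).card := Nat.cast_nonneg _
      nlinarith
    rcases (X i0).eq_empty_or_nonempty with he | ⟨p, hp⟩
    · refine ⟨0, X, fun i => subset_rfl, htriv, fun x hx => ?_⟩
      have := hx i0
      rw [he] at this
      simp at this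
    · refine ⟨p, Function.update X i0 {p}, fun i => ?_, fun i => ?_, fun x hx => ?_⟩
      · by_cases h : i = i0
        · subst h; simpa using hp
        · simp [h]
      · by_cases h : i = i0
        · subst h
          simp only [Function.update_self, Finset.card_singleton, Nat.cast_one]
          have : ((X i).card : ℝ) ≤ ((d + 1 : ℕ) : ℝ) := by exact_mod_cast hi0.le
          nlinarith
        · rw [Function.update_of_ne h]; exact htriv i
      · have := hx i0
        simp only [Function.update_self, Finset.mem_singleton] at this
        exact subset_convexHull _ _ ⟨i0, this⟩
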